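/- arXiv:2309.13478 — 3 statements merged into one kernel-verified Lean document; each statement's English description precedes it below -/
import Mathlib

section
/- Let 1 ≤ d ≤ D be integers, let W be a d-dimensional linear subspace of ℝ^D, and let ν denote the d-dimensional Hausdorff measure on ℝ^D restricted to W ∩ B̄₁(0), where B̄₁(0) is the closed unit ball of ℝ^D. Let x̄ = (1/ν(ℝ^D)) ∫ x dν(x) and Σ[ν] = (1/ν(ℝ^D)) ∫ (x − x̄)(x − x̄)ᵀ dν(x). Then the eigenvalues of the symmetric matrix Σ[ν], listed in decreasing order with multiplicity, are 1/(d+2) repeated d times followed by 0 repeated D − d times. -/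
open MeasureTheory Matrix Metric

/-- The mean of a finite measure on `ℝ^D`. -/
noncomputable def meanVec (D : ℕ) (ν : Measure (EuclideanSpace ℝ (Fin D))) :
    EuclideanSpace ℝ (Fin D) :=
  (ν Set.univ).toReal⁻¹ • ∫ x, x ∂ν

/-- The covariance matrix `Σ[ν]` of a finite measure on `ℝ^D`. -/
noncomputable def covMatrix (D : ℕ) (ν : Measure (EuclideanSpace ℝ (Fin D))) :
    Matrix (Fin D) (Fin D) ℝ :=
  fun i j => (ν Set.univ).toReal⁻¹ *
    ∫ x, (x i - meanVec D ν i) * (x j - meanVec D ν j) ∂ν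

/-- The first moment of the unit ball vanishes for a symmetric measure. -/
theorem setIntegral_closedBall_id {E : Type*} [NormedAddCommGroup E] [NormedSpace ℝ E]
    [MeasurableSpace E] [BorelSpace E] (μ : Measure E) [μ.IsNegInvariant] :
    ∫ x in closedBall (0 : E) 1, x ∂μ = 0 := by
  have h := (Measure.measurePreserving_neg μ).setIntegral_preimage_emb
    (MeasurableEquiv.neg E).measurableEmbedding (fun x : E => x) (closedBall 0 1)
  rw [show (Neg.neg ⁻¹' closedBall 0 1 : Set E) = closedBall 0 1 by ext; simp,
    integral_neg] at h
  have : IsAddTorsionFree E := .of_isTorsionFree ℝ E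
  exact self_eq_neg.mp h.symm

section BallMoments

open Module InnerProductSpace

variable {E : Type*} [NormedAddCommGroup E] [InnerProductSpace ℝ E] [FiniteDimensional ℝ E]
  [MeasurableSpace E] [BorelSpace E]

/-- The second moment of the norm over the unit ball, for any Haar measure. -/
theorem setIntegral_closedBall_norm_sq [Nontrivial E] (μ : Measure E) [μ.IsAddHaarMeasure] :
    ∫ x in closedBall (0 : E) 1, ‖x‖ ^ 2 ∂μ =
      finrank ℝ E / (finrank ℝ E + 2) * μ.real (closedBall 0 1) := by
  have hdim : 0 < finrank ℝ E := finrank_pos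
  have hball : μ.real (closedBall (0 : E) 1) = μ.real (ball 0 1) := by
    simp only [Measure.real, Measure.addHaar_closedBall_eq_addHaar_ball]
  have hind : (closedBall (0 : E) 1).indicator (fun x => ‖x‖ ^ 2) =
      fun x => (Set.Iic (1 : ℝ)).indicator (fun r => r ^ 2) ‖x‖ := by
    ext x
    by_cases hx : ‖x‖ ≤ 1 <;> simp [hx]
  rw [← integral_indicator measurableSet_closedBall, hind, integral_fun_norm_addHaar, hball]
  have hrad : ∫ y in Set.Ioi (0 : ℝ), y ^ (finrank ℝ E - 1) •
      (Set.Iic (1 : ℝ)).indicator (fun r => r ^ 2) y = 1 / (finrank ℝ E + 2) := by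
    have hfun : (fun y : ℝ => y ^ (finrank ℝ E - 1) •
        (Set.Iic (1 : ℝ)).indicator (fun r => r ^ 2) y) =
        (Set.Iic (1 : ℝ)).indicator (fun y => y ^ (finrank ℝ E + 1)) := by
      ext y
      by_cases hy : y ∈ Set.Iic (1 : ℝ)
      · simp only [Set.indicator_of_mem hy, smul_eq_mul, ← pow_add]
        congr 1
        omega
      · simp [Set.indicator_of_notMem hy]
    rw [hfun, setIntegral_indicator measurableSet_Iic, Set.Ioi_inter_Iic,
      ← intervalIntegral.integral_of_le zero_le_one, integral_pow]
    push_cast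
    simp
    ring
  rw [hrad, nsmul_eq_mul, smul_eq_mul]
  ring

/-- A finite-dimensional inner product space is isotropic with respect to its Hausdorff measure:
the second moments of the unit ball are multiples of the inner product. -/
theorem setIntegral_closedBall_inner_mul_inner [Nontrivial E] (u v : E) :
    ∫ x in closedBall (0 : E) 1, ⟪u, x⟫_ℝ * ⟪v, x⟫_ℝ ∂μH[finrank ℝ E] =
      (1 / (finrank ℝ E + 2) * (μH[finrank ℝ E] : Measure E).real (closedBall 0 1)) *
        ⟪u, v⟫_ℝ := by
  set μ : Measure E := μH[finrank ℝ E] with hμ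
  have h_int (f : E → ℝ) (hf : Continuous f) : IntegrableOn f (closedBall 0 1) μ :=
    hf.continuousOn.integrableOn_compact (isCompact_closedBall 0 1)
  have hinv (e : E ≃ₗᵢ[ℝ] E) (f : E → ℝ) :
      ∫ x in closedBall (0 : E) 1, f (e x) ∂μ = ∫ x in closedBall (0 : E) 1, f x ∂μ := by
    have h := (e.toIsometryEquiv.measurePreserving_hausdorffMeasure
      (finrank ℝ E)).setIntegral_preimage_emb
      e.toHomeomorph.measurableEmbedding f (closedBall 0 1)
    have hpre : e.toIsometryEquiv ⁻¹' closedBall 0 1 = closedBall (0 : E) 1 := by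
      ext x
      simp
    rw [hpre] at h
    exact h
  let Q (w : E) : ℝ := ∫ x in closedBall (0 : E) 1, ⟪w, x⟫_ℝ ^ 2 ∂μ
  have hQ_norm (w w' : E) (h : ‖w‖ = ‖w'‖) : Q w = Q w' := by
    have := hinv (Submodule.reflection (ℝ ∙ (w - w'))ᗮ) (fun x => ⟪w', x⟫_ℝ ^ 2)
    simp only [Q]
    rw [← this]
    congr 1 with x
    rw [← LinearIsometryEquiv.inner_map_map (Submodule.reflection (ℝ ∙ (w - w'))ᗮ) w x,
      Submodule.reflection_sub h]
  have hQ_smul (t : ℝ) (w : E) : Q (t • w) = t ^ 2 * Q w := by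
    simp only [Q, inner_smul_left, mul_pow, integral_const_mul]
    simp
  let b := stdOrthonormalBasis ℝ E
  have i₀ : Fin (finrank ℝ E) := ⟨0, finrank_pos⟩
  have hQ (w : E) : Q w = ‖w‖ ^ 2 * Q (b i₀) := by
    rw [← hQ_smul]
    apply hQ_norm
    simp [norm_smul]
  have hsum : finrank ℝ E * Q (b i₀) = ∫ x in closedBall (0 : E) 1, ‖x‖ ^ 2 ∂μ := by
    have hb (x : E) : ‖x‖ ^ 2 = ∑ i, ⟪b i, x⟫_ℝ ^ 2 := by
      simpa using (b.sum_sq_norm_inner_right x).symm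
    simp_rw [hb]
    rw [integral_finsetSum _ fun i _ => h_int _ (by fun_prop)]
    have hbi (i) : ∫ x in closedBall (0 : E) 1, ⟪b i, x⟫_ℝ ^ 2 ∂μ = Q (b i₀) :=
      hQ_norm _ _ (by simp)
    simp [hbi]
  have hdim : (0 : ℝ) < finrank ℝ E := by exact_mod_cast finrank_pos
  have hc : Q (b i₀) = 1 / (finrank ℝ E + 2) * μ.real (closedBall 0 1) := by
    rw [setIntegral_closedBall_norm_sq μ] at hsum
    apply mul_left_cancel₀ hdim.ne'
    rw [hsum]
    ring
  rw [← hc]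
  have hpol (x : E) :
      ⟪u, x⟫_ℝ * ⟪v, x⟫_ℝ = (⟪u + v, x⟫_ℝ ^ 2 - ⟪u - v, x⟫_ℝ ^ 2) / 4 := by
    rw [inner_add_left, inner_sub_left]
    ring
  simp_rw [hpol]
  rw [integral_div, integral_sub (h_int _ (by fun_prop)) (h_int _ (by fun_prop))]
  change (Q (u + v) - Q (u - v)) / 4 = _
  rw [hQ (u + v), hQ (u - v), norm_add_sq_real, norm_sub_sq_real]
  ring

end BallMoments

/-- The Hausdorff measure on the unit ball of a subspace is the push-forward of the Hausdorff
measure on the unit ball of the subspace regarded as a space of its own. -/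
theorem Submodule.hausdorffMeasure_restrict_inter_closedBall {E : Type*} [NormedAddCommGroup E]
    [NormedSpace ℝ E] [MeasurableSpace E] [BorelSpace E] (W : Submodule ℝ E) {s : ℝ} (hs : 0 ≤ s) :
    (μH[s] : Measure E).restrict ((W : Set E) ∩ closedBall 0 1) =
      ((μH[s] : Measure W).restrict (closedBall 0 1)).map W.subtype := by
  have hpre : (W.subtype ⁻¹' closedBall 0 1 : Set W) = closedBall 0 1 := by
    ext x
    simp
  have hmap := W.subtypeₗᵢ.isometry.map_hausdorffMeasure (Or.inl hs)
  have hmeas : Measurable W.subtype := W.subtypeₗᵢ.continuous.measurable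
  rw [← hpre, ← Measure.restrict_map hmeas measurableSet_closedBall]
  change _ = ((μH[s]).map W.subtypeₗᵢ).restrict _
  rw [hmap, Measure.restrict_restrict measurableSet_closedBall, Set.inter_comm]
  simp

/-- If the columns of `A` are orthonormal, then `c • A * Aᵀ` has eigenvalue `c` with the number
of columns as multiplicity, and `0` for the rest. -/
theorem Matrix.IsHermitian.map_eigenvalues_of_eq_smul_mul_transpose {m n : Type*} [Fintype m]
    [Fintype n] [DecidableEq m] [DecidableEq n] {M : Matrix m m ℝ} (hM : M.IsHermitian) {c : ℝ}
    {A : Matrix m n ℝ} (hA : Aᵀ * A = 1) (hMA : M = (c • A) * Aᵀ)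
    (hcard : Fintype.card n ≤ Fintype.card m) :
    Multiset.map hM.eigenvalues Finset.univ.val =
      Multiset.replicate (Fintype.card n) c +
        Multiset.replicate (Fintype.card m - Fintype.card n) 0 := by
  have hroots := hM.roots_charpoly_eq_eigenvalues
  have hchar : M.charpoly = Polynomial.X ^ (Fintype.card m - Fintype.card n) *
      (Polynomial.X - Polynomial.C c) ^ Fintype.card n := by
    rw [hMA, charpoly_mul_comm_of_le _ _ hcard, Matrix.mul_smul, hA, smul_one_eq_diagonal,
      charpoly_diagonal]
    simp
  have hne : Polynomial.X ^ (Fintype.card m - Fintype.card n) *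
      (Polynomial.X - Polynomial.C c) ^ Fintype.card n ≠ 0 :=
    mul_ne_zero (pow_ne_zero _ Polynomial.X_ne_zero) (pow_ne_zero _ (Polynomial.X_sub_C_ne_zero c))
  rw [hchar, Polynomial.roots_mul hne, Polynomial.roots_pow, Polynomial.roots_pow,
    Polynomial.roots_X, Polynomial.roots_X_sub_C, Multiset.nsmul_singleton,
    Multiset.nsmul_singleton, add_comm] at hroots
  exact hroots.symm

theorem stmt0 (d D : ℕ) (hd : 1 ≤ d) (hdD : d ≤ D)
    (W : Submodule ℝ (EuclideanSpace ℝ (Fin D))) (hW : Module.finrank ℝ W = d)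
    (ν : Measure (EuclideanSpace ℝ (Fin D)))
    (hν : ν = (μH[d]).restrict ((W : Set (EuclideanSpace ℝ (Fin D))) ∩ closedBall 0 1)) :
    ∃ h : (covMatrix D ν).IsHermitian,
      Multiset.map h.eigenvalues Finset.univ.val =
        Multiset.replicate d ((1 : ℝ) / (d + 2)) + Multiset.replicate (D - d) 0 := by
  subst hν
  have : Nontrivial W := Module.nontrivial_of_finrank_pos (R := ℝ) (by omega)
  set μ : Measure W := μH[Module.finrank ℝ W] with hμ
  set B : Set W := closedBall 0 1
  have hνmap : (μH[d] : Measure (EuclideanSpace ℝ (Fin D))).restrict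
      ((W : Set (EuclideanSpace ℝ (Fin D))) ∩ closedBall 0 1) =
      (μ.restrict B).map W.subtype := by
    rw [hμ, hW]
    exact W.hausdorffMeasure_restrict_inter_closedBall d.cast_nonneg
  rw [hνmap]
  have hemb : MeasurableEmbedding W.subtype :=
    W.closed_of_finiteDimensional.isClosedEmbedding_subtypeVal.measurableEmbedding
  have hneg : μ.IsNegInvariant :=
    ⟨(IsometryEquiv.neg W).map_hausdorffMeasure _⟩
  have hmean : meanVec D ((μ.restrict B).map W.subtype) = 0 := by
    have h : ∫ x in B, W.subtypeL x ∂μ = W.subtypeL (∫ x in B, x ∂μ) :=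
      W.subtypeL.integral_comp_comm
        (continuous_id.continuousOn.integrableOn_compact (isCompact_closedBall 0 1))
    rw [meanVec, hemb.integral_map]
    change _ • ∫ x in B, W.subtypeL x ∂μ = 0
    rw [h, setIntegral_closedBall_id]
    simp
  have hmass : (((μ.restrict B).map W.subtype) Set.univ).toReal = μ.real B := by
    rw [hemb.map_apply, Set.preimage_univ, Measure.restrict_apply_univ, Measure.real]
  have hmass_ne : μ.real B ≠ 0 :=
    (ENNReal.toReal_pos (measure_closedBall_pos μ 0 one_pos).ne'
      (isCompact_closedBall 0 1).measure_lt_top.ne).ne'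
  let b := (stdOrthonormalBasis ℝ W).reindex (finCongr hW)
  let A : Matrix (Fin D) (Fin d) ℝ := Matrix.of fun i k => (b k : EuclideanSpace ℝ (Fin D)) i
  have hA : Aᵀ * A = 1 := by
    ext k l
    have h := orthonormal_iff_ite.mp b.orthonormal l k
    rw [Submodule.coe_inner, PiLp.inner_apply] at h
    rw [Matrix.mul_apply, Matrix.one_apply]
    simpa [A, eq_comm] using h.symm
  have hcov : covMatrix D ((μ.restrict B).map W.subtype) = ((1 / (d + 2) : ℝ) • A) * Aᵀ := by
    ext i j
    let p (i : Fin D) : W := W.orthogonalProjectionOnto (EuclideanSpace.single i 1)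
    have hp (i : Fin D) (x : W) : (x : EuclideanSpace ℝ (Fin D)) i = inner ℝ (p i) x := by
      simp [p, EuclideanSpace.inner_single_left]
    have hpp : inner ℝ (p i) (p j) = (A * Aᵀ) i j := by
      rw [← b.sum_inner_mul_inner, Matrix.mul_apply]
      refine Finset.sum_congr rfl fun k _ => ?_
      rw [real_inner_comm (p j), ← hp, ← hp]
      rfl
    rw [covMatrix, hmean, hmass, hemb.integral_map]
    simp only [PiLp.zero_apply, sub_zero, Submodule.subtype_apply, hp]
    rw [setIntegral_closedBall_inner_mul_inner, hpp, hW, Matrix.smul_mul, Matrix.smul_apply,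
      smul_eq_mul]
    rw [hμ, hW] at hmass_ne ⊢
    change _ * (_ * μH[d].real B * _) = _
    field_simp
  have hherm : (covMatrix D ((μ.restrict B).map W.subtype)).IsHermitian := by
    rw [hcov, Matrix.IsHermitian, conjTranspose_eq_transpose_of_trivial]
    simp
  refine ⟨hherm, ?_⟩
  simpa using hherm.map_eigenvalues_of_eq_smul_mul_transpose hA hcov (by simpa using hdD)
end

section
/- There exists a constant C > 0, depending only on d and D, such that for all symmetric d×d real matrices M_1, …, M_{D−d} with Λ = max_j ‖M_j‖ ≤ 1 and all x ∈ ℝ^d with ‖x‖ ≤ 1, the density S(x) = √(det g(x)) satisfies |S(x) − 1 − 2 Σ_{j=1}^{D−d} xᵀ M_j² x| ≤ C Λ⁴. -/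
open MeasureTheory Matrix Real

/-- First fundamental form of the graph of the quadratic embedding
`x ↦ (x, xᵀM₁x, …, xᵀM_{D-d}x)`. -/
noncomputable def gMat {d m : ℕ} (M : Fin m → Matrix (Fin d) (Fin d) ℝ)
    (x : Fin d → ℝ) : Matrix (Fin d) (Fin d) ℝ :=
  1 + (4 : ℝ) • ∑ k, vecMulVec (M k *ᵥ x) (M k *ᵥ x)

/-- The density `S(x) = √(det g(x))`. -/
noncomputable def Sdens {d m : ℕ} (M : Fin m → Matrix (Fin d) (Fin d) ℝ)
    (x : Fin d → ℝ) : ℝ :=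
  Real.sqrt (gMat M x).det

/-- `Λ`, the maximum of the operator norms of the matrices `M j`. -/
noncomputable def Lam {d m : ℕ} (M : Fin m → Matrix (Fin d) (Fin d) ℝ) : ℝ :=
  ⨆ j, ‖Matrix.toEuclideanCLM (𝕜 := ℝ) (M j)‖

theorem Finset.one_add_sum_le_prod_one_add {ι : Type*} (s : Finset ι) {f : ι → ℝ}
    (hf : ∀ i, 0 ≤ f i) : 1 + ∑ i ∈ s, f i ≤ ∏ i ∈ s, (1 + f i) := by
  classical
  induction s using Finset.induction_on with
  | empty => simp
  | insert a s ha ih =>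
    rw [Finset.sum_insert ha, Finset.prod_insert ha]
    nlinarith [hf a, mul_le_mul_of_nonneg_left ih (hf a),
      mul_nonneg (hf a) (Finset.sum_nonneg fun i (_ : i ∈ s) => hf i)]

/-- The determinant of `1 + A` for `A` positive semidefinite, to first order in the trace. -/
theorem Matrix.PosSemidef.det_one_add_bounds {n : Type*} [Fintype n] [DecidableEq n]
    {A : Matrix n n ℝ} (hA : A.PosSemidef) :
    1 + A.trace ≤ (1 + A).det ∧ (1 + A).det ≤ Real.exp A.trace := by
  have hdet : (1 + A).det = ∏ i, (1 + hA.1.eigenvalues i) := by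
    have h := congrArg (Polynomial.eval (-1)) hA.1.charpoly_eq
    rw [Matrix.eval_charpoly, Polynomial.eval_prod] at h
    have h1 : Matrix.scalar n (-1 : ℝ) - A = -(1 + A) := by
      rw [map_neg, map_one]; abel
    have h2 : ∀ i, Polynomial.eval (-1 : ℝ)
        (Polynomial.X - Polynomial.C ((hA.1.eigenvalues i : ℝ))) =
        -(1 + hA.1.eigenvalues i) := by
      intro i; simp; ring
    rw [h1, Matrix.det_neg] at h
    simp only [RCLike.ofReal_real_eq_id, id, h2] at h
    rw [Finset.prod_neg] at h
    exact mul_left_cancel₀ (pow_ne_zero _ (by norm_num)) h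
  have htr : A.trace = ∑ i, hA.1.eigenvalues i := by
    simpa using hA.1.trace_eq_sum_eigenvalues
  rw [hdet, htr]
  constructor
  · exact Finset.one_add_sum_le_prod_one_add _ hA.eigenvalues_nonneg
  · exact Real.prod_one_add_le_exp_sum _ hA.eigenvalues_nonneg

theorem Real.exp_le_one_add_add_sq_mul_exp {t : ℝ} (ht : 0 ≤ t) :
    Real.exp t ≤ 1 + t + t ^ 2 * Real.exp t := by
  have h : Real.exp t - 1 ≤ t * Real.exp t := by
    have h1 := mul_le_mul_of_nonneg_left (Real.add_one_le_exp (-t)) (Real.exp_pos t).le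
    rw [← Real.exp_add, add_neg_cancel, Real.exp_zero] at h1
    linarith
  nlinarith [mul_le_mul_of_nonneg_left h ht]

theorem Lam_nonneg {d m : ℕ} (M : Fin m → Matrix (Fin d) (Fin d) ℝ) : 0 ≤ Lam M :=
  Real.iSup_nonneg fun _ => norm_nonneg _

theorem dotProduct_mulVec_le_Lam_sq {d m : ℕ} (M : Fin m → Matrix (Fin d) (Fin d) ℝ)
    (x : Fin d → ℝ) (hx : ∑ i, x i ^ 2 ≤ 1) (j : Fin m) :
    (M j *ᵥ x) ⬝ᵥ (M j *ᵥ x) ≤ Lam M ^ 2 := by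
  have hsq : ∀ v : Fin d → ℝ, v ⬝ᵥ v = ‖WithLp.toLp 2 v‖ ^ 2 := fun v => by
    simp [EuclideanSpace.norm_sq_eq, dotProduct, ← sq]
  have hx1 : ‖WithLp.toLp 2 x‖ ≤ 1 := by
    rw [← abs_of_nonneg (norm_nonneg (WithLp.toLp 2 x)), ← sq_le_one_iff_abs_le_one]
    simpa [EuclideanSpace.norm_sq_eq] using hx
  have hle : ‖Matrix.toEuclideanCLM (𝕜 := ℝ) (M j)‖ ≤ Lam M :=
    le_ciSup (f := fun j => ‖Matrix.toEuclideanCLM (𝕜 := ℝ) (M j)‖)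
      (Set.finite_range _).bddAbove j
  rw [hsq, ← Matrix.toEuclideanCLM_toLp (𝕜 := ℝ)]
  refine pow_le_pow_left₀ (norm_nonneg _) ?_ 2
  calc _ ≤ _ := ContinuousLinearMap.le_opNorm _ _
    _ ≤ Lam M * 1 := mul_le_mul hle hx1 (norm_nonneg _) (Lam_nonneg M)
    _ = Lam M := mul_one _

theorem abs_sqrt_sub_one_add_le {T E : ℝ} (hT : 0 ≤ T) (hE : 0 ≤ E) :
    |√(1 + 4 * T + E) - 1 - 2 * T| ≤ |E - 4 * T ^ 2| := by
  set s := √(1 + 4 * T + E) with hs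
  have hs0 : 0 ≤ s := Real.sqrt_nonneg _
  have hs2 : s ^ 2 = 1 + 4 * T + E := Real.sq_sqrt (by positivity)
  have h : E - 4 * T ^ 2 = (s - 1 - 2 * T) * (s + 1 + 2 * T) := by linear_combination -hs2
  rw [h, abs_mul]
  refine le_mul_of_one_le_right (abs_nonneg _) ?_
  rw [abs_of_nonneg (by positivity)]
  linarith

theorem stmt4 (d D : ℕ) (hd : 1 ≤ d) (hD : d < D) :
    ∃ C > 0, ∀ M : Fin (D - d) → Matrix (Fin d) (Fin d) ℝ,
      (∀ j, (M j).IsSymm) → Lam M ≤ 1 →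
      ∀ x : Fin d → ℝ, ∑ i, x i ^ 2 ≤ 1 →
        |Sdens M x - 1 - 2 * ∑ j, x ⬝ᵥ ((M j * M j) *ᵥ x)|
          ≤ C * Lam M ^ 4 := by
  have hm : (0 : ℝ) < ((D - d : ℕ) : ℝ) := by exact_mod_cast Nat.sub_pos_of_lt hD
  set m : ℝ := ((D - d : ℕ) : ℝ) with hmdef
  refine ⟨16 * m ^ 2 * Real.exp (4 * m), by positivity, fun M hM hL x hx => ?_⟩
  have hsum : ∑ j, x ⬝ᵥ ((M j * M j) *ᵥ x) = ∑ j, (M j *ᵥ x) ⬝ᵥ (M j *ᵥ x) := by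
    refine Finset.sum_congr rfl fun j _ => ?_
    rw [← Matrix.mulVec_mulVec, Matrix.dotProduct_mulVec, ← Matrix.mulVec_transpose, (hM j).eq]
  rw [hsum]
  set T := ∑ j, (M j *ᵥ x) ⬝ᵥ (M j *ᵥ x) with hTdef
  have hT : 0 ≤ T := Finset.sum_nonneg fun j _ =>
    Finset.sum_nonneg fun i _ => mul_self_nonneg _
  have hL0 := Lam_nonneg M
  have hTL : T ≤ m * Lam M ^ 2 := by
    calc T ≤ ∑ _j : Fin (D - d), Lam M ^ 2 :=
          Finset.sum_le_sum fun j _ => dotProduct_mulVec_le_Lam_sq M x hx j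
      _ = m * Lam M ^ 2 := by simp [hmdef]
  have hTm : T ≤ m := hTL.trans (mul_le_of_le_one_right hm.le (pow_le_one₀ hL0 hL))
  have hpsd : ((4 : ℝ) • ∑ k, vecMulVec (M k *ᵥ x) (M k *ᵥ x)).PosSemidef := by
    refine Matrix.PosSemidef.smul (Matrix.posSemidef_sum _ fun k _ => ?_) (by norm_num)
    simpa using Matrix.posSemidef_vecMulVec_self_star (M k *ᵥ x)
  have htr : ((4 : ℝ) • ∑ k, vecMulVec (M k *ᵥ x) (M k *ᵥ x)).trace = 4 * T := by
    simp [Matrix.trace_smul, Matrix.trace_sum, Matrix.trace_vecMulVec, hTdef]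
  obtain ⟨hlow, hup⟩ := hpsd.det_one_add_bounds
  rw [htr] at hlow hup
  change 1 + 4 * T ≤ (gMat M x).det at hlow
  change (gMat M x).det ≤ _ at hup
  obtain ⟨E, hE⟩ : ∃ E, (gMat M x).det = 1 + 4 * T + E := ⟨_, (add_sub_cancel _ _).symm⟩
  have hE0 : 0 ≤ E := by linarith
  have hexp : Real.exp (4 * T) ≤ Real.exp (4 * m) := Real.exp_le_exp.2 (by linarith)
  have hE1 : E ≤ 16 * T ^ 2 * Real.exp (4 * m) := by
    have h1 := Real.exp_le_one_add_add_sq_mul_exp (t := 4 * T) (by positivity)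
    have h2 := mul_le_mul_of_nonneg_left hexp (show 0 ≤ 16 * T ^ 2 by positivity)
    linarith
  have hT2 : 4 * T ^ 2 ≤ 16 * T ^ 2 * Real.exp (4 * m) := by
    nlinarith [sq_nonneg T, mul_le_mul_of_nonneg_left
      (Real.one_le_exp (show 0 ≤ 4 * m by positivity)) (sq_nonneg T)]
  rw [Sdens, hE]
  calc |√(1 + 4 * T + E) - 1 - 2 * T| ≤ |E - 4 * T ^ 2| := abs_sqrt_sub_one_add_le hT hE0
    _ ≤ 16 * T ^ 2 * Real.exp (4 * m) := abs_le.2 ⟨by linarith, by linarith [sq_nonneg T]⟩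
    _ ≤ 16 * (m * Lam M ^ 2) ^ 2 * Real.exp (4 * m) := by gcongr
    _ = 16 * m ^ 2 * Real.exp (4 * m) * Lam M ^ 4 := by ring
end

section
/- There exists a constant C > 0, depending only on d and D, such that for all symmetric d×d real matrices M_1, …, M_{D−d} with Λ = max_j ‖M_j‖ ≤ 1 and every unit vector θ* ∈ ℝ^d, one has ∫_R (x·θ*)² S(x) dx / ∫_R S(x) dx ≤ 1/(d+2) + (5d² + 18d + 24)·A/((d+2)³(d+4)) + d·B/(2(d+2)²(d+4)) + C Λ⁴. -/
open MeasureTheory Matrix Real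

/-- The region `R = {x : ‖x‖² + Σⱼ Qⱼ(x)² ≤ 1}`, where `Qⱼ(x) = xᵀMⱼx`. -/
def regionR {d m : ℕ} (M : Fin m → Matrix (Fin d) (Fin d) ℝ) : Set (Fin d → ℝ) :=
  {x | ∑ i, x i ^ 2 + ∑ j, (x ⬝ᵥ (M j *ᵥ x)) ^ 2 ≤ 1}

/-- `A = Σⱼ tr(Mⱼ²)`. -/
noncomputable def Aconst {d m : ℕ} (M : Fin m → Matrix (Fin d) (Fin d) ℝ) : ℝ :=
  ∑ j, (M j * M j).trace

/-- `B = Σⱼ (tr Mⱼ)²`. -/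
noncomputable def Bconst {d m : ℕ} (M : Fin m → Matrix (Fin d) (Fin d) ℝ) : ℝ :=
  ∑ j, (M j).trace ^ 2

theorem integrable_pow_mul_gaussian (n : ℕ) :
    Integrable fun x : ℝ ↦ x ^ n * exp (-(1 / 2) * x ^ 2) := by
  have h := integrable_rpow_mul_exp_neg_mul_sq (b := 1 / 2) (by norm_num) (s := n)
    (by have : (0 : ℝ) ≤ n := n.cast_nonneg
        linarith)
  simpa only [rpow_natCast] using h

theorem hasDerivAt_pow_mul_gaussian (n : ℕ) (x : ℝ) :
    HasDerivAt (fun x : ℝ ↦ x ^ n * exp (-(1 / 2) * x ^ 2))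
      (n * (x ^ (n - 1) * exp (-(1 / 2) * x ^ 2)) - x ^ (n + 1) * exp (-(1 / 2) * x ^ 2)) x := by
  have h := (hasDerivAt_pow n x).mul (((hasDerivAt_pow 2 x).const_mul (-(1 / 2) : ℝ)).exp)
  refine h.congr_deriv ?_
  simp only [Nat.cast_ofNat, Nat.add_one_sub_one, pow_succ]
  ring

theorem integral_pow_succ_mul_gaussian (n : ℕ) :
    ∫ x : ℝ, x ^ (n + 1) * exp (-(1 / 2) * x ^ 2) =
      n * ∫ x : ℝ, x ^ (n - 1) * exp (-(1 / 2) * x ^ 2) := by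
  have h1 := (integrable_pow_mul_gaussian (n - 1)).const_mul (n : ℝ)
  have h2 := integrable_pow_mul_gaussian (n + 1)
  have h := integral_eq_zero_of_hasDerivAt_of_integrable (hasDerivAt_pow_mul_gaussian n)
    (h1.sub h2) (integrable_pow_mul_gaussian n)
  rw [integral_sub h1 h2, integral_const_mul] at h
  linarith

/-- The radial Gaussian moment `∫₀^∞ rⁿ e^{-r²/2} dr`. -/
noncomputable def radialMoment (n : ℕ) : ℝ :=
  ∫ r in Set.Ioi (0 : ℝ), r ^ n * exp (-(1 / 2) * r ^ 2)

theorem radialMoment_add_two (n : ℕ) :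
    radialMoment (n + 2) = (n + 1) * radialMoment n := by
  have h1 := ((integrable_pow_mul_gaussian n).const_mul ((n : ℝ) + 1)).integrableOn
    (s := Set.Ioi (0 : ℝ))
  have h2 := (integrable_pow_mul_gaussian (n + 2)).integrableOn (s := Set.Ioi (0 : ℝ))
  have hder : ∀ x : ℝ, HasDerivAt (fun x : ℝ ↦ x ^ (n + 1) * exp (-(1 / 2) * x ^ 2))
      (((n : ℝ) + 1) * (x ^ n * exp (-(1 / 2) * x ^ 2)) -
        x ^ (n + 2) * exp (-(1 / 2) * x ^ 2)) x := fun x ↦ by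
    simpa using hasDerivAt_pow_mul_gaussian (n + 1) x
  have hlim := tendsto_zero_of_hasDerivAt_of_integrableOn_Ioi (a := (0 : ℝ))
    (fun x _ ↦ hder x) (h1.sub h2) (integrable_pow_mul_gaussian (n + 1)).integrableOn
  have h := integral_Ioi_of_hasDerivAt_of_tendsto' (a := (0 : ℝ)) (fun x _ ↦ hder x)
    (h1.sub h2) hlim
  rw [integral_sub h1 h2, integral_const_mul] at h
  simp only [radialMoment]
  simp at h
  simp
  linarith

theorem radialMoment_pos (n : ℕ) : 0 < radialMoment n := by
  rw [radialMoment, setIntegral_pos_iff_support_of_nonneg_ae]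
  · have : (Function.support fun r : ℝ ↦ r ^ n * exp (-(1 / 2) * r ^ 2)) ∩ Set.Ioi 0 =
        Set.Ioi 0 := by
      ext r
      simp only [Set.mem_inter_iff, Function.mem_support, Set.mem_Ioi, and_iff_right_iff_imp]
      intro hr
      positivity
    rw [this]
    simp
  · filter_upwards [ae_restrict_mem measurableSet_Ioi] with r hr
    have : 0 < r := hr
    simp only [Pi.zero_apply]
    positivity
  · exact (integrable_pow_mul_gaussian n).integrableOn

/-- The unit sphere of `ℝᵈ`. -/
abbrev USphere (d : ℕ) : Type := Metric.sphere (0 : EuclideanSpace ℝ (Fin d)) 1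

/-- The surface measure on the unit sphere. -/
noncomputable abbrev surf (d : ℕ) : Measure (USphere d) :=
  (volume : Measure (EuclideanSpace ℝ (Fin d))).toSphere

/-- The coordinate vector of a point of the unit sphere. -/
def USphere.vec {d : ℕ} (w : USphere d) : Fin d → ℝ := WithLp.ofLp w.1

theorem USphere.continuous_vec {d : ℕ} : Continuous (USphere.vec (d := d)) :=
  (PiLp.continuous_ofLp 2 _).comp continuous_subtype_val

theorem USphere.sum_sq {d : ℕ} (w : USphere d) : ∑ i, w.vec i ^ 2 = 1 := by
  have h := w.2
  rw [mem_sphere_zero_iff_norm] at h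
  have h2 := EuclideanSpace.real_norm_sq_eq w.1
  rw [h] at h2
  simpa [USphere.vec] using h2.symm

theorem polar_of_euclidean {d : ℕ} (hd : 1 ≤ d) (F : EuclideanSpace ℝ (Fin d) → ℝ)
    (hF : Integrable F) :
    Integrable (fun w : USphere d ↦ ∫ r in Set.Ioi (0 : ℝ), r ^ (d - 1) * F (r • w.1)) (surf d) ∧
    ∫ x, F x = ∫ w : USphere d, (∫ r in Set.Ioi (0 : ℝ), r ^ (d - 1) * F (r • w.1)) ∂(surf d) := by
  set μ : Measure (EuclideanSpace ℝ (Fin d)) := volume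
  have : Nonempty (Fin d) := ⟨⟨0, hd⟩⟩
  have hmp := μ.measurePreserving_homeomorphUnitSphereProd
  have hemb := (homeomorphUnitSphereProd (EuclideanSpace ℝ (Fin d))).measurableEmbedding
  set G : Metric.sphere (0 : EuclideanSpace ℝ (Fin d)) 1 × Set.Ioi (0 : ℝ) → ℝ :=
    fun p ↦ F (p.2.1 • p.1.1) with hG
  have hcomp : G ∘ homeomorphUnitSphereProd (EuclideanSpace ℝ (Fin d)) = F ∘ Subtype.val := by
    ext x
    have := congrArg Subtype.val
      ((homeomorphUnitSphereProd (EuclideanSpace ℝ (Fin d))).symm_apply_apply x)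
    simp only [homeomorphUnitSphereProd_symm_apply_coe] at this
    simp only [hG, Function.comp_apply, this]
  have hint : Integrable G (μ.toSphere.prod (Measure.volumeIoiPow
      (Module.finrank ℝ (EuclideanSpace ℝ (Fin d)) - 1))) := by
    rw [← hmp.integrable_comp_emb hemb, hcomp]
    have := hF.integrableOn (s := ({0}ᶜ : Set (EuclideanSpace ℝ (Fin d))))
    rwa [integrableOn_iff_comap_subtypeVal (by measurability)] at this
  have hinner : ∀ w : USphere d, ∫ r, G (w, r) ∂(Measure.volumeIoiPow
      (Module.finrank ℝ (EuclideanSpace ℝ (Fin d)) - 1)) =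
      ∫ r in Set.Ioi (0 : ℝ), r ^ (d - 1) * F (r • w.1) := by
    intro w
    simp only [Measure.volumeIoiPow, ENNReal.ofReal, finrank_euclideanSpace_fin]
    rw [integral_withDensity_eq_integral_smul,
      integral_subtype_comap measurableSet_Ioi
        fun a ↦ Real.toNNReal (a ^ (d - 1)) • F (a • w.1),
      setIntegral_congr_fun measurableSet_Ioi fun x hx ↦ ?_]
    · simp only [NNReal.smul_def, smul_eq_mul]
      rw [Real.coe_toNNReal _ (pow_nonneg (le_of_lt hx) _)]
    · exact (measurable_subtype_coe.pow_const _).real_toNNReal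
  constructor
  · have := hint.integral_prod_left
    simpa only [hinner] using this
  · calc ∫ x, F x ∂μ = ∫ x in ({0}ᶜ : Set (EuclideanSpace ℝ (Fin d))), F x ∂μ := by
          rw [restrict_compl_singleton]
      _ = ∫ x : ({0}ᶜ : Set (EuclideanSpace ℝ (Fin d))), F x ∂(μ.comap (↑)) := by
          rw [integral_subtype_comap (measurableSet_singleton _).compl F]
      _ = ∫ p, G p ∂(μ.toSphere.prod (Measure.volumeIoiPow
            (Module.finrank ℝ (EuclideanSpace ℝ (Fin d)) - 1))) := by
          rw [← hmp.integral_comp hemb]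
          exact integral_congr_ae (.of_forall fun x ↦ (congrFun hcomp x).symm)
      _ = _ := by
          rw [integral_prod _ hint]
          simp only [hinner, μ]

theorem integral_polar {d : ℕ} (hd : 1 ≤ d) (F : (Fin d → ℝ) → ℝ) (hF : Integrable F) :
    Integrable (fun w : USphere d ↦ ∫ r in Set.Ioi (0 : ℝ), r ^ (d - 1) * F (r • w.vec))
      (surf d) ∧
    ∫ x, F x = ∫ w : USphere d, (∫ r in Set.Ioi (0 : ℝ), r ^ (d - 1) * F (r • w.vec))
      ∂(surf d) := by
  have hmp := PiLp.volume_preserving_ofLp (Fin d)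
  have hemb : MeasurableEmbedding (WithLp.ofLp : EuclideanSpace ℝ (Fin d) → (Fin d → ℝ)) :=
    (MeasurableEquiv.toLp 2 (Fin d → ℝ)).symm.measurableEmbedding
  have h := polar_of_euclidean hd (F ∘ WithLp.ofLp) ((hmp.integrable_comp_emb hemb).2 hF)
  rw [← hmp.integral_comp hemb]
  exact h

/-- The unnormalised Gaussian weight. -/
noncomputable def gaussWeight {d : ℕ} (x : Fin d → ℝ) : ℝ := exp (-(1 / 2) * ∑ i, x i ^ 2)

theorem gaussWeight_eq_prod {d : ℕ} (x : Fin d → ℝ) :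
    gaussWeight x = ∏ i, exp (-(1 / 2) * x i ^ 2) := by
  rw [gaussWeight, Finset.mul_sum, Real.exp_sum]

theorem eval_monomial_mul_gaussWeight {d : ℕ} (s : Fin d →₀ ℕ) (a : ℝ) (x : Fin d → ℝ) :
    MvPolynomial.eval x (MvPolynomial.monomial s a) * gaussWeight x =
      a * ∏ i, (x i ^ s i * exp (-(1 / 2) * x i ^ 2)) := by
  rw [MvPolynomial.eval_monomial, gaussWeight_eq_prod, Finset.prod_mul_distrib, mul_assoc,
    Finsupp.prod_fintype _ _ (fun i ↦ pow_zero _)]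

theorem integrable_eval_mul_gaussWeight {d : ℕ} (p : MvPolynomial (Fin d) ℝ) :
    Integrable fun x : Fin d → ℝ ↦ MvPolynomial.eval x p * gaussWeight x := by
  induction p using MvPolynomial.induction_on' with
  | monomial s a =>
    simp only [eval_monomial_mul_gaussWeight]
    exact (Integrable.fintype_prod (f := fun i (t : ℝ) ↦ t ^ s i * exp (-(1 / 2) * t ^ 2))
      fun i ↦ integrable_pow_mul_gaussian (s i)).const_mul a
  | add p q hp hq =>
    simp only [map_add, add_mul]
    exact hp.add hq

/-- Integration of polynomials against the Gaussian weight. -/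
noncomputable def gaussInt (d : ℕ) : MvPolynomial (Fin d) ℝ →ₗ[ℝ] ℝ where
  toFun p := ∫ x : Fin d → ℝ, MvPolynomial.eval x p * gaussWeight x
  map_add' p q := by
    simp only [map_add, add_mul]
    exact integral_add (integrable_eval_mul_gaussWeight p) (integrable_eval_mul_gaussWeight q)
  map_smul' c p := by
    simp only [MvPolynomial.smul_eval, mul_assoc, integral_const_mul, RingHom.id_apply,
      smul_eq_mul]

theorem gaussInt_monomial {d : ℕ} (s : Fin d →₀ ℕ) (a : ℝ) :
    gaussInt d (MvPolynomial.monomial s a) =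
      a * ∏ i, ∫ t : ℝ, t ^ s i * exp (-(1 / 2) * t ^ 2) := by
  rw [gaussInt, LinearMap.coe_mk, AddHom.coe_mk]
  simp only [eval_monomial_mul_gaussWeight]
  rw [integral_const_mul, integral_fintype_prod_volume_eq_prod
    (fun i (t : ℝ) ↦ t ^ s i * exp (-(1 / 2) * t ^ 2))]

/-- Gaussian integration by parts for polynomials. -/
theorem gaussInt_X_mul {d : ℕ} (i : Fin d) (p : MvPolynomial (Fin d) ℝ) :
    gaussInt d (MvPolynomial.X i * p) = gaussInt d (MvPolynomial.pderiv i p) := by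
  induction p using MvPolynomial.induction_on' with
  | monomial s a =>
    rw [MvPolynomial.X, MvPolynomial.monomial_mul, one_mul, MvPolynomial.pderiv_monomial,
      gaussInt_monomial, gaussInt_monomial, ← Finset.mul_prod_erase _ _ (Finset.mem_univ i),
      ← Finset.mul_prod_erase _ _ (Finset.mem_univ i)]
    have h1 : (Finsupp.single i 1 + s : Fin d →₀ ℕ) i = s i + 1 := by simp [add_comm]
    have h2 : (s - Finsupp.single i 1 : Fin d →₀ ℕ) i = s i - 1 := by simp
    rw [h1, h2, integral_pow_succ_mul_gaussian, ← mul_assoc, ← mul_assoc, ← mul_assoc]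
    congr 1
    refine Finset.prod_congr rfl fun j hj ↦ ?_
    have hji : j ≠ i := Finset.ne_of_mem_erase hj
    simp [Finsupp.single_eq_of_ne hji]
  | add p q hp hq => simp only [mul_add, map_add, hp, hq]

section GaussianMoments

variable {d : ℕ}

/-- The linear form with coefficient vector `a`. -/
noncomputable def linPoly (a : Fin d → ℝ) : MvPolynomial (Fin d) ℝ :=
  ∑ i, MvPolynomial.C (a i) * MvPolynomial.X i

/-- The quadratic form with matrix `N`. -/
noncomputable def quadPoly (N : Matrix (Fin d) (Fin d) ℝ) : MvPolynomial (Fin d) ℝ :=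
  ∑ i, MvPolynomial.X i * linPoly (N i)

/-- The derivation along the linear vector field `x ↦ N x`. -/
noncomputable def linDeriv (N : Matrix (Fin d) (Fin d) ℝ) :
    Derivation ℝ (MvPolynomial (Fin d) ℝ) (MvPolynomial (Fin d) ℝ) :=
  ∑ i, linPoly (N i) • MvPolynomial.pderiv i

theorem linDeriv_apply (N : Matrix (Fin d) (Fin d) ℝ) (p : MvPolynomial (Fin d) ℝ) :
    linDeriv N p = ∑ i, linPoly (N i) * MvPolynomial.pderiv i p := by
  have h := congrFun (map_sum (Derivation.coeFnAddMonoidHom (R := ℝ)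
    (A := MvPolynomial (Fin d) ℝ) (M := MvPolynomial (Fin d) ℝ))
    (fun i ↦ linPoly (N i) • MvPolynomial.pderiv i) Finset.univ) p
  exact h.trans (Finset.sum_apply _ _ _)

theorem pderiv_linPoly (i : Fin d) (a : Fin d → ℝ) :
    MvPolynomial.pderiv i (linPoly a) = MvPolynomial.C (a i) := by
  simp [linPoly, MvPolynomial.pderiv_X, Pi.single_apply]

theorem eval_linPoly (a x : Fin d → ℝ) : MvPolynomial.eval x (linPoly a) = x ⬝ᵥ a := by
  simp [linPoly, dotProduct, mul_comm]

theorem eval_quadPoly (N : Matrix (Fin d) (Fin d) ℝ) (x : Fin d → ℝ) :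
    MvPolynomial.eval x (quadPoly N) = x ⬝ᵥ (N *ᵥ x) := by
  simp only [quadPoly, map_sum, map_mul, MvPolynomial.eval_X, eval_linPoly]
  simp only [dotProduct, mulVec, mul_comm]

theorem linDeriv_linPoly (N : Matrix (Fin d) (Fin d) ℝ) (hN : N.IsSymm) (a : Fin d → ℝ) :
    linDeriv N (linPoly a) = linPoly (N *ᵥ a) := by
  apply MvPolynomial.funext
  intro x
  rw [linDeriv_apply]
  simp only [pderiv_linPoly, map_sum, map_mul, eval_linPoly, MvPolynomial.eval_C]
  rw [dotProduct_mulVec, ← mulVec_transpose, hN.eq]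
  simp only [dotProduct, mulVec, mul_comm]

theorem linDeriv_quadPoly (N : Matrix (Fin d) (Fin d) ℝ) (hN : N.IsSymm) :
    linDeriv N (quadPoly N) = 2 * quadPoly (N * N) := by
  have hX : ∀ i, linDeriv N (MvPolynomial.X i) = linPoly (N i) := fun i ↦ by
    simp [linDeriv_apply, MvPolynomial.pderiv_X, Pi.single_apply]
  apply MvPolynomial.funext
  intro x
  rw [map_mul, eval_quadPoly, quadPoly, map_sum]
  simp only [Derivation.leibniz, hX, linDeriv_linPoly N hN, smul_eq_mul, map_sum, map_add,
    map_mul, MvPolynomial.eval_X, eval_linPoly, map_ofNat, Finset.sum_add_distrib]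
  have h1 : ∑ i, x i * (x ⬝ᵥ (N *ᵥ N i)) = x ⬝ᵥ ((N * N) *ᵥ x) := by
    rw [← mulVec_mulVec, dotProduct]
    refine Finset.sum_congr rfl fun i _ ↦ ?_
    rw [dotProduct_mulVec, ← mulVec_transpose, hN.eq, dotProduct_comm]
    rfl
  have h2 : ∑ i, (x ⬝ᵥ N i) * (x ⬝ᵥ N i) = x ⬝ᵥ ((N * N) *ᵥ x) := by
    rw [← mulVec_mulVec, dotProduct_mulVec, ← mulVec_transpose, hN.eq, dotProduct]
    refine Finset.sum_congr rfl fun i _ ↦ ?_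
    rw [dotProduct_comm]
    rfl
  rw [h1, h2, two_mul]

theorem gaussInt_quadPoly_mul (N : Matrix (Fin d) (Fin d) ℝ) (p : MvPolynomial (Fin d) ℝ) :
    gaussInt d (quadPoly N * p) = N.trace * gaussInt d p + gaussInt d (linDeriv N p) := by
  simp only [quadPoly, Finset.sum_mul, mul_assoc, map_sum, gaussInt_X_mul,
    Derivation.leibniz, pderiv_linPoly, smul_eq_mul, map_add, linDeriv_apply, trace,
    Finset.sum_add_distrib, diag_apply]
  rw [add_comm]
  congr 1
  refine Finset.sum_congr rfl fun i _ ↦ ?_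
  rw [mul_comm, MvPolynomial.C_mul', map_smul, smul_eq_mul]

theorem gaussInt_linPoly_mul (a : Fin d → ℝ) (p : MvPolynomial (Fin d) ℝ) :
    gaussInt d (linPoly a * p) = ∑ i, a i * gaussInt d (MvPolynomial.pderiv i p) := by
  simp only [linPoly, Finset.sum_mul, map_sum, MvPolynomial.C_mul', smul_mul_assoc, map_smul,
    gaussInt_X_mul, smul_eq_mul]

theorem gaussInt_lin_lin (a b : Fin d → ℝ) :
    gaussInt d (linPoly a * linPoly b) = (a ⬝ᵥ b) * gaussInt d 1 := by
  rw [gaussInt_linPoly_mul, dotProduct, Finset.sum_mul]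
  refine Finset.sum_congr rfl fun i _ ↦ ?_
  rw [pderiv_linPoly, ← mul_one (MvPolynomial.C (b i)), MvPolynomial.C_mul', map_smul, smul_eq_mul,
    mul_assoc]

theorem gaussInt_quad (N : Matrix (Fin d) (Fin d) ℝ) :
    gaussInt d (quadPoly N) = N.trace * gaussInt d 1 := by
  simpa using gaussInt_quadPoly_mul N 1

theorem gaussInt_quad_sq (N : Matrix (Fin d) (Fin d) ℝ) (hN : N.IsSymm) :
    gaussInt d (quadPoly N * quadPoly N) =
      (N.trace ^ 2 + 2 * (N * N).trace) * gaussInt d 1 := by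
  rw [gaussInt_quadPoly_mul, linDeriv_quadPoly N hN, two_mul, map_add, gaussInt_quad,
    gaussInt_quad]
  ring

theorem gaussInt_quad_lin_lin (N : Matrix (Fin d) (Fin d) ℝ) (hN : N.IsSymm) (a b : Fin d → ℝ) :
    gaussInt d (quadPoly N * (linPoly a * linPoly b)) =
      (N.trace * (a ⬝ᵥ b) + 2 * (a ⬝ᵥ (N *ᵥ b))) * gaussInt d 1 := by
  have hs : (N *ᵥ a) ⬝ᵥ b = a ⬝ᵥ (N *ᵥ b) := by
    rw [dotProduct_mulVec, ← mulVec_transpose, hN.eq]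
  rw [gaussInt_quadPoly_mul, Derivation.leibniz, linDeriv_linPoly N hN, linDeriv_linPoly N hN,
    smul_eq_mul, smul_eq_mul, map_add, gaussInt_lin_lin, gaussInt_lin_lin, gaussInt_lin_lin,
    dotProduct_comm b, hs]
  ring

theorem gaussInt_quad_sq_lin_sq (N : Matrix (Fin d) (Fin d) ℝ) (hN : N.IsSymm) (a : Fin d → ℝ) :
    gaussInt d (quadPoly N * quadPoly N * (linPoly a * linPoly a)) =
      ((N.trace ^ 2 + 2 * (N * N).trace) * (a ⬝ᵥ a) + 4 * N.trace * (a ⬝ᵥ (N *ᵥ a)) +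
        8 * ((N *ᵥ a) ⬝ᵥ (N *ᵥ a))) * gaussInt d 1 := by
  have hNN : (N * N).IsSymm := by
    rw [Matrix.IsSymm, transpose_mul, hN.eq]
  have hs : a ⬝ᵥ (N *ᵥ (N *ᵥ a)) = (N *ᵥ a) ⬝ᵥ (N *ᵥ a) := by
    rw [dotProduct_mulVec, ← mulVec_transpose, hN.eq]
  have hs2 : a ⬝ᵥ ((N * N) *ᵥ a) = (N *ᵥ a) ⬝ᵥ (N *ᵥ a) := by
    rw [← mulVec_mulVec, hs]
  have hder : linDeriv N (quadPoly N * (linPoly a * linPoly a)) =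
      (2 : ℝ) • (quadPoly N * (linPoly a * linPoly (N *ᵥ a))) +
        (2 : ℝ) • (quadPoly (N * N) * (linPoly a * linPoly a)) := by
    rw [Derivation.leibniz, Derivation.leibniz, linDeriv_linPoly N hN, linDeriv_quadPoly N hN]
    simp only [smul_eq_mul, two_smul]
    ring
  rw [mul_assoc, gaussInt_quadPoly_mul, hder, map_add, map_smul, map_smul,
    gaussInt_quad_lin_lin N hN, gaussInt_quad_lin_lin N hN, gaussInt_quad_lin_lin _ hNN, hs, hs2,
    smul_eq_mul, smul_eq_mul]
  ring

/-- Polar coordinates turn Gaussian moments into spherical moments. -/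
theorem gaussInt_eq_sphere (hd : 1 ≤ d) (k : ℕ) (p : MvPolynomial (Fin d) ℝ)
    (hp : ∀ (r : ℝ) (x : Fin d → ℝ),
      MvPolynomial.eval (r • x) p = r ^ k * MvPolynomial.eval x p) :
    gaussInt d p =
      radialMoment (d - 1 + k) * ∫ w, MvPolynomial.eval (USphere.vec w) p ∂(surf d) := by
  have h := (integral_polar hd _ (integrable_eval_mul_gaussWeight p)).2
  rw [gaussInt, LinearMap.coe_mk, AddHom.coe_mk, h, ← integral_const_mul]
  refine integral_congr_ae (.of_forall fun w ↦ ?_)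
  simp only [radialMoment]
  rw [← integral_mul_const]
  refine integral_congr_ae (.of_forall fun r ↦ ?_)
  have hw : gaussWeight (r • w.vec) = exp (-(1 / 2) * r ^ 2) := by
    simp only [gaussWeight, Pi.smul_apply, smul_eq_mul, mul_pow, ← Finset.mul_sum, w.sum_sq,
      mul_one]
  simp only [hp, hw, pow_add]
  ring

end GaussianMoments

section SphereMoments

variable {d : ℕ}

theorem gaussInt_one (hd : 1 ≤ d) :
    gaussInt d 1 = radialMoment (d - 1) * (surf d).real Set.univ := by
  rw [gaussInt_eq_sphere hd 0 1 (by simp)]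
  simp

theorem radialMoment_dim_add_two (hd : 1 ≤ d) :
    radialMoment (d - 1 + 2) = d * radialMoment (d - 1) := by
  rw [radialMoment_add_two]
  push_cast [hd]
  ring

theorem radialMoment_dim_add_four (hd : 1 ≤ d) :
    radialMoment (d - 1 + 4) = (d + 2) * d * radialMoment (d - 1) := by
  rw [radialMoment_add_two (d - 1 + 2), radialMoment_dim_add_two hd]
  push_cast [hd]
  ring

theorem radialMoment_dim_add_six (hd : 1 ≤ d) :
    radialMoment (d - 1 + 6) = (d + 4) * (d + 2) * d * radialMoment (d - 1) := by
  rw [radialMoment_add_two (d - 1 + 4), radialMoment_dim_add_four hd]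
  push_cast [hd]
  ring

theorem eval_smul_linPoly (r : ℝ) (x a : Fin d → ℝ) :
    MvPolynomial.eval (r • x) (linPoly a) = r * MvPolynomial.eval x (linPoly a) := by
  simp [eval_linPoly]

theorem eval_smul_quadPoly (r : ℝ) (x : Fin d → ℝ) (N : Matrix (Fin d) (Fin d) ℝ) :
    MvPolynomial.eval (r • x) (quadPoly N) = r ^ 2 * MvPolynomial.eval x (quadPoly N) := by
  simp only [eval_quadPoly, mulVec_smul, smul_dotProduct, dotProduct_smul, smul_eq_mul]
  ring

theorem dotProduct_mul_self_mulVec {N : Matrix (Fin d) (Fin d) ℝ} (hN : N.IsSymm)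
    (x : Fin d → ℝ) : x ⬝ᵥ ((N * N) *ᵥ x) = (N *ᵥ x) ⬝ᵥ (N *ᵥ x) := by
  rw [← mulVec_mulVec, dotProduct_mulVec, ← mulVec_transpose, hN.eq]

theorem integral_sphere_lin_sq (hd : 1 ≤ d) (a : Fin d → ℝ) (ha : a ⬝ᵥ a = 1) :
    ∫ w : USphere d, (w.vec ⬝ᵥ a) ^ 2 ∂(surf d) = (surf d).real Set.univ * (1 / d) := by
  have hd0 : (0 : ℝ) < d := by exact_mod_cast hd
  have hG := radialMoment_pos (d - 1)
  have h := gaussInt_eq_sphere hd 2 (linPoly a * linPoly a) (fun r x ↦ by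
    simp only [map_mul, eval_smul_linPoly]
    ring)
  rw [gaussInt_lin_lin, gaussInt_one hd, ha, radialMoment_dim_add_two hd] at h
  simp only [map_mul, eval_linPoly] at h
  simp only [sq] at h ⊢
  field_simp at h ⊢
  linarith

theorem integral_sphere_mulVec_sq (hd : 1 ≤ d) (N : Matrix (Fin d) (Fin d) ℝ) (hN : N.IsSymm) :
    ∫ w : USphere d, (N *ᵥ w.vec) ⬝ᵥ (N *ᵥ w.vec) ∂(surf d) =
      (surf d).real Set.univ * ((N * N).trace / d) := by
  have hd0 : (0 : ℝ) < d := by exact_mod_cast hd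
  have hG := radialMoment_pos (d - 1)
  have h := gaussInt_eq_sphere hd 2 (quadPoly (N * N)) (fun r x ↦ eval_smul_quadPoly ..)
  rw [gaussInt_quad, gaussInt_one hd, radialMoment_dim_add_two hd] at h
  simp only [eval_quadPoly, dotProduct_mul_self_mulVec hN] at h
  field_simp at h ⊢
  linarith

theorem integral_sphere_quad_sq (hd : 1 ≤ d) (N : Matrix (Fin d) (Fin d) ℝ) (hN : N.IsSymm) :
    ∫ w : USphere d, (w.vec ⬝ᵥ (N *ᵥ w.vec)) ^ 2 ∂(surf d) =
      (surf d).real Set.univ * ((N.trace ^ 2 + 2 * (N * N).trace) / (d * (d + 2))) := by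
  have hd0 : (0 : ℝ) < d := by exact_mod_cast hd
  have hG := radialMoment_pos (d - 1)
  have h := gaussInt_eq_sphere hd 4 (quadPoly N * quadPoly N) (fun r x ↦ by
    simp only [map_mul, eval_smul_quadPoly]
    ring)
  rw [gaussInt_quad_sq N hN, gaussInt_one hd, radialMoment_dim_add_four hd] at h
  simp only [map_mul, eval_quadPoly] at h
  simp only [sq] at h ⊢
  field_simp at h ⊢
  linarith

theorem integral_sphere_lin_sq_mul_mulVec_sq (hd : 1 ≤ d) (N : Matrix (Fin d) (Fin d) ℝ)
    (hN : N.IsSymm) (a : Fin d → ℝ) (ha : a ⬝ᵥ a = 1) :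
    ∫ w : USphere d, (w.vec ⬝ᵥ a) ^ 2 * ((N *ᵥ w.vec) ⬝ᵥ (N *ᵥ w.vec)) ∂(surf d) =
      (surf d).real Set.univ *
        (((N * N).trace + 2 * ((N *ᵥ a) ⬝ᵥ (N *ᵥ a))) / (d * (d + 2))) := by
  have hd0 : (0 : ℝ) < d := by exact_mod_cast hd
  have hG := radialMoment_pos (d - 1)
  have hNN : (N * N).IsSymm := by
    rw [Matrix.IsSymm, transpose_mul, hN.eq]
  have h := gaussInt_eq_sphere hd 4 (quadPoly (N * N) * (linPoly a * linPoly a)) (fun r x ↦ by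
    simp only [map_mul, eval_smul_quadPoly, eval_smul_linPoly]
    ring)
  rw [gaussInt_quad_lin_lin _ hNN, gaussInt_one hd, radialMoment_dim_add_four hd, ha,
    dotProduct_mul_self_mulVec hN] at h
  simp only [map_mul, eval_quadPoly, eval_linPoly, dotProduct_mul_self_mulVec hN] at h
  simp only [mul_comm ((_ ⬝ᵥ a) ^ 2)]
  simp only [sq] at h ⊢
  field_simp at h ⊢
  linarith

theorem integral_sphere_lin_sq_mul_quad_sq (hd : 1 ≤ d) (N : Matrix (Fin d) (Fin d) ℝ)
    (hN : N.IsSymm) (a : Fin d → ℝ) (ha : a ⬝ᵥ a = 1) :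
    ∫ w : USphere d, (w.vec ⬝ᵥ a) ^ 2 * (w.vec ⬝ᵥ (N *ᵥ w.vec)) ^ 2 ∂(surf d) =
      (surf d).real Set.univ *
        ((N.trace ^ 2 + 2 * (N * N).trace + 4 * N.trace * (a ⬝ᵥ (N *ᵥ a)) +
          8 * ((N *ᵥ a) ⬝ᵥ (N *ᵥ a))) / (d * (d + 2) * (d + 4))) := by
  have hd0 : (0 : ℝ) < d := by exact_mod_cast hd
  have hG := radialMoment_pos (d - 1)
  have h := gaussInt_eq_sphere hd 6 (quadPoly N * quadPoly N * (linPoly a * linPoly a))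
    (fun r x ↦ by
      simp only [map_mul, eval_smul_quadPoly, eval_smul_linPoly]
      ring)
  rw [gaussInt_quad_sq_lin_sq N hN, gaussInt_one hd, radialMoment_dim_add_six hd, ha] at h
  simp only [map_mul, eval_quadPoly, eval_linPoly] at h
  simp only [mul_comm ((_ ⬝ᵥ a) ^ 2)]
  simp only [sq] at h ⊢
  field_simp at h ⊢
  linarith

end SphereMoments

section RadialProfile

/-- The positive solution `ρ` of `ρ² + q ρ⁴ = 1`. -/
noncomputable def rootRadius (q : ℝ) : ℝ := √(2 / (1 + √(1 + 4 * q)))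

theorem rootRadius_pos (q : ℝ) : 0 < rootRadius q := by
  rw [rootRadius]
  positivity

theorem rootRadius_eq {q : ℝ} (hq : 0 ≤ q) : rootRadius q ^ 2 + rootRadius q ^ 4 * q = 1 := by
  have hs := Real.sq_sqrt (show 0 ≤ 1 + 4 * q by linarith)
  have hs0 := Real.sqrt_nonneg (1 + 4 * q)
  have h2 : rootRadius q ^ 2 = 2 / (1 + √(1 + 4 * q)) := Real.sq_sqrt (by positivity)
  have h4 : rootRadius q ^ 4 = (rootRadius q ^ 2) ^ 2 := by ring
  rw [h4, h2]
  generalize √(1 + 4 * q) = s at hs hs0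
  have : q = (s ^ 2 - 1) / 4 := by linarith
  subst this
  field_simp
  ring

theorem rootRadius_le_one {q : ℝ} (hq : 0 ≤ q) : rootRadius q ≤ 1 := by
  have h := rootRadius_eq hq
  have h0 := rootRadius_pos q
  have : 0 ≤ rootRadius q ^ 4 * q := by positivity
  nlinarith

theorem le_rootRadius_iff {q r : ℝ} (hq : 0 ≤ q) (hr : 0 ≤ r) :
    r ^ 2 + r ^ 4 * q ≤ 1 ↔ r ≤ rootRadius q := by
  have h := rootRadius_eq hq
  have h0 := rootRadius_pos q
  constructor
  · intro hle
    by_contra! hlt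
    have h2 : rootRadius q ^ 2 < r ^ 2 := by gcongr
    have h4 : rootRadius q ^ 4 * q ≤ r ^ 4 * q := by gcongr
    linarith
  · intro hle
    rw [← h]
    gcongr

theorem one_sub_rootRadius_le {q : ℝ} (hq : 0 ≤ q) : 1 - rootRadius q ≤ q := by
  have h := rootRadius_eq hq
  have h0 := rootRadius_pos q
  have h1 := rootRadius_le_one hq
  have h4 : rootRadius q ^ 4 ≤ 1 := pow_le_one₀ h0.le h1
  nlinarith

theorem abs_rootRadius_sub_le {q : ℝ} (hq : 0 ≤ q) :
    |rootRadius q - 1 + q / 2| ≤ 4 * q ^ 2 := by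
  have h := rootRadius_eq hq
  have h0 := rootRadius_pos q
  have h1 := rootRadius_le_one hq
  have hle := one_sub_rootRadius_le hq
  set r := rootRadius q
  have key : 2 * (1 + r) * (r - 1 + q / 2) =
      q * (1 - r) * (2 * r ^ 3 + 2 * r ^ 2 + 2 * r + 1) := by
    linear_combination 2 * h
  have hc : 2 * r ^ 3 + 2 * r ^ 2 + 2 * r + 1 ≤ 7 := by
    have := pow_le_one₀ (n := 2) h0.le h1
    have := pow_le_one₀ (n := 3) h0.le h1
    linarith
  have hub : q * (1 - r) * (2 * r ^ 3 + 2 * r ^ 2 + 2 * r + 1) ≤ q * q * 7 := by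
    have : 0 ≤ 1 - r := by linarith
    gcongr
  have hlb : 0 ≤ q * (1 - r) * (2 * r ^ 3 + 2 * r ^ 2 + 2 * r + 1) := by
    have : 0 ≤ 1 - r := by linarith
    positivity
  have hpos : 0 ≤ r - 1 + q / 2 := by
    by_contra! hneg
    nlinarith
  rw [abs_of_nonneg hpos]
  nlinarith

theorem one_sub_rootRadius_pow_le {q : ℝ} (hq : 0 ≤ q) (N : ℕ) :
    1 - rootRadius q ^ N ≤ N * q := by
  have h1 := one_sub_rootRadius_le hq
  have h := one_add_mul_sub_le_pow (a := rootRadius q)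
    (by linarith [rootRadius_pos q]) N
  have : (N : ℝ) * (1 - rootRadius q) ≤ N * q := by gcongr
  linarith

theorem abs_rootRadius_pow_sub_le {q : ℝ} (hq : 0 ≤ q) (N : ℕ) :
    |rootRadius q ^ N - 1 + N * q / 2| ≤ 4 * N ^ 2 * q ^ 2 := by
  induction N with
  | zero => simp
  | succ N ih =>
    have h0 := rootRadius_pos q
    have h1 := rootRadius_le_one hq
    have hle := one_sub_rootRadius_le hq
    have hr := abs_rootRadius_sub_le hq
    have hN : (0 : ℝ) ≤ N := N.cast_nonneg
    rw [abs_le] at ih hr ⊢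
    set r := rootRadius q
    have e : r ^ (N + 1) - 1 + ((N + 1 : ℕ) : ℝ) * q / 2 =
        r * (r ^ N - 1 + N * q / 2) + (r - 1 + q / 2) + (1 - r) * (N * q / 2) := by
      push_cast
      ring
    have b1 : r * (r ^ N - 1 + N * q / 2) ≤ 4 * N ^ 2 * q ^ 2 := by
      have : 0 ≤ 4 * N ^ 2 * q ^ 2 := by positivity
      nlinarith
    have b2 : -(4 * N ^ 2 * q ^ 2) ≤ r * (r ^ N - 1 + N * q / 2) := by
      have : 0 ≤ 4 * N ^ 2 * q ^ 2 := by positivity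
      nlinarith
    have b3 : 0 ≤ (1 - r) * (N * q / 2) := by
      have : 0 ≤ 1 - r := by linarith
      positivity
    have b4 : (1 - r) * (N * q / 2) ≤ q * (N * q / 2) := by gcongr
    have b5 : 0 ≤ (N : ℝ) * q ^ 2 := by positivity
    rw [e]
    push_cast
    constructor <;> nlinarith

theorem inv_one_add_le_rootRadius {q : ℝ} (hq : 0 ≤ q) : 1 / (1 + q) ≤ rootRadius q := by
  have h := rootRadius_eq hq
  have h0 := rootRadius_pos q
  have h1 := rootRadius_le_one hq
  rw [div_le_iff₀ (by linarith)]
  have h2 : rootRadius q ^ 2 ≤ rootRadius q := by nlinarith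
  have h4 : rootRadius q ^ 4 ≤ rootRadius q := by
    calc rootRadius q ^ 4 ≤ rootRadius q ^ 1 := pow_le_pow_of_le_one h0.le h1 (by norm_num)
      _ = _ := pow_one _
  nlinarith

theorem abs_integral_profile_sub_le (n : ℕ) {q p ε : ℝ} (hq : 0 ≤ q) (hp : 0 ≤ p)
    {s : ℝ → ℝ} (hs : Continuous s)
    (hsb : ∀ r ∈ Set.Icc (0 : ℝ) 1, |s r - (1 + 2 * p * r ^ 2)| ≤ ε) :
    |(∫ r in Set.Ioc 0 (rootRadius q), r ^ n * s r) -
      (1 / ((n : ℝ) + 1) - q / 2 + 2 * p / ((n : ℝ) + 3))| ≤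
      ε + 4 * ((n : ℝ) + 1) * q ^ 2 + 2 * p * q := by
  have h0 := rootRadius_pos q
  have h1 := rootRadius_le_one hq
  have hε : 0 ≤ ε := (abs_nonneg _).trans (hsb 0 (by simp))
  rw [← intervalIntegral.integral_of_le h0.le]
  set ρ := rootRadius q with hρ
  have hmain : ∫ r in (0 : ℝ)..ρ, r ^ n * (1 + 2 * p * r ^ 2) =
      ρ ^ (n + 1) / ((n : ℝ) + 1) + 2 * p * (ρ ^ (n + 3) / ((n : ℝ) + 3)) := by
    have e : ∀ r : ℝ, r ^ n * (1 + 2 * p * r ^ 2) = r ^ n + 2 * p * r ^ (n + 2) := fun r ↦ by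
      ring
    simp only [e]
    rw [intervalIntegral.integral_add (by simp) ((by simp :
      IntervalIntegrable (fun r : ℝ ↦ r ^ (n + 2)) volume 0 ρ).const_mul _),
      intervalIntegral.integral_const_mul, integral_pow, integral_pow]
    push_cast
    simp only [zero_pow (Nat.succ_ne_zero _), sub_zero]
    ring
  have hdiff : |(∫ r in (0 : ℝ)..ρ, r ^ n * s r) -
      ∫ r in (0 : ℝ)..ρ, r ^ n * (1 + 2 * p * r ^ 2)| ≤ ε := by
    rw [← intervalIntegral.integral_sub (by apply Continuous.intervalIntegrable; fun_prop)
      (by apply Continuous.intervalIntegrable; fun_prop)]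
    have := intervalIntegral.norm_integral_le_of_norm_le_const (a := 0) (b := ρ) (C := ε)
      (f := fun r ↦ r ^ n * s r - r ^ n * (1 + 2 * p * r ^ 2)) (fun r hr ↦ by
        rw [Set.uIoc_of_le h0.le] at hr
        have hr1 : r ≤ 1 := hr.2.trans h1
        rw [← mul_sub, norm_mul, norm_pow, Real.norm_eq_abs, Real.norm_eq_abs, abs_of_pos hr.1]
        have := hsb r ⟨hr.1.le, hr1⟩
        have h2 := pow_le_one₀ (n := n) hr.1.le hr1
        have h3 := pow_nonneg hr.1.le n
        calc r ^ n * |s r - (1 + 2 * p * r ^ 2)| ≤ 1 * ε := by gcongr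
          _ = ε := one_mul ε)
    rw [Real.norm_eq_abs, sub_zero, abs_of_pos h0] at this
    exact this.trans (mul_le_of_le_one_right hε h1)
  have hN := abs_rootRadius_pow_sub_le hq (n + 1)
  have hN3 := one_sub_rootRadius_pow_le hq (n + 3)
  have hN3' := pow_le_one₀ (n := n + 3) h0.le h1
  rw [← hρ] at hN hN3
  push_cast at hN hN3
  have hn : (0 : ℝ) ≤ n := n.cast_nonneg
  have e1 : |ρ ^ (n + 1) / ((n : ℝ) + 1) - 1 / ((n : ℝ) + 1) + q / 2| ≤
      4 * ((n : ℝ) + 1) * q ^ 2 := by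
    have : ρ ^ (n + 1) / ((n : ℝ) + 1) - 1 / ((n : ℝ) + 1) + q / 2 =
        (ρ ^ (n + 1) - 1 + ((n : ℝ) + 1) * q / 2) / ((n : ℝ) + 1) := by
      field_simp
    rw [this, abs_div, abs_of_pos (by positivity : (0 : ℝ) < n + 1), div_le_iff₀ (by positivity)]
    linarith
  have e2 : 2 * p * (ρ ^ (n + 3) / ((n : ℝ) + 3)) ≤ 2 * p / ((n : ℝ) + 3) := by
    rw [mul_div_assoc']
    gcongr ?_ / _
    exact mul_le_of_le_one_right (by positivity) hN3'
  have e3 : 2 * p / ((n : ℝ) + 3) - 2 * p * q ≤ 2 * p * (ρ ^ (n + 3) / ((n : ℝ) + 3)) := by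
    rw [mul_div_assoc', sub_le_iff_le_add, div_le_iff₀ (by positivity), add_mul,
      div_mul_cancel₀ _ (by positivity)]
    nlinarith
  rw [hmain] at hdiff
  rw [abs_le] at hdiff e1 ⊢
  constructor <;> linarith [hdiff.1, hdiff.2, e1.1, e1.2]

theorem le_integral_profile (n : ℕ) {q c : ℝ} (hq : 0 ≤ q) (hqc : q ≤ c)
    {s : ℝ → ℝ} (hs : Continuous s) (hsb : ∀ r, 1 ≤ s r) :
    (1 / (1 + c)) ^ (n + 1) / ((n : ℝ) + 1) ≤
      ∫ r in Set.Ioc 0 (rootRadius q), r ^ n * s r := by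
  have h0 := rootRadius_pos q
  rw [← intervalIntegral.integral_of_le h0.le]
  have hc : 1 / (1 + c) ≤ rootRadius q :=
    (one_div_le_one_div_of_le (by linarith) (by linarith)).trans (inv_one_add_le_rootRadius hq)
  have hc0 : 0 ≤ 1 / (1 + c) := one_div_nonneg.2 (by linarith)
  calc (1 / (1 + c)) ^ (n + 1) / ((n : ℝ) + 1) ≤ rootRadius q ^ (n + 1) / ((n : ℝ) + 1) := by
        gcongr
    _ = ∫ r in (0 : ℝ)..rootRadius q, r ^ n := by
        rw [integral_pow, zero_pow (Nat.succ_ne_zero _), sub_zero]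
    _ ≤ _ := by
        refine intervalIntegral.integral_mono_on h0.le (by simp)
          (by apply Continuous.intervalIntegrable; fun_prop) fun r hr ↦ ?_
        exact le_mul_of_one_le_right (pow_nonneg hr.1 n) (hsb r)

end RadialProfile

section Determinant

variable {d : ℕ}

theorem one_le_eigenvalues_one_add {H : Matrix (Fin d) (Fin d) ℝ} (hH : H.PosSemidef)
    (hg : (1 + H).IsHermitian) (i : Fin d) : 1 ≤ hg.eigenvalues i := by
  have hv := hg.mulVec_eigenvectorBasis i
  set v : Fin d → ℝ := WithLp.ofLp (hg.eigenvectorBasis i) with hvdef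
  have hvv : v ⬝ᵥ v = 1 := by
    have h1 := hg.eigenvectorBasis.orthonormal.1 i
    have h2 := EuclideanSpace.real_norm_sq_eq (hg.eigenvectorBasis i)
    rw [h1] at h2
    simp only [dotProduct, ← sq]
    linarith
  have hpos := hH.dotProduct_mulVec_nonneg v
  rw [star_trivial] at hpos
  have h := congrArg (fun u ↦ v ⬝ᵥ u) hv
  simp only [add_mulVec, one_mulVec, dotProduct_add, dotProduct_smul, hvv, smul_eq_mul] at h
  linarith

theorem trace_one_add {H : Matrix (Fin d) (Fin d) ℝ} (hg : (1 + H).IsHermitian) :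
    H.trace = ∑ i, (hg.eigenvalues i - 1) := by
  have h := hg.trace_eq_sum_eigenvalues
  simp only [trace_add, trace_one, Fintype.card_fin, RCLike.ofReal_real_eq_id, id] at h
  simp only [Finset.sum_sub_distrib, Finset.sum_const, Finset.card_univ, Fintype.card_fin,
    nsmul_eq_mul, mul_one]
  linarith

theorem one_add_trace_le_det {H : Matrix (Fin d) (Fin d) ℝ} (hH : H.PosSemidef) :
    1 + H.trace ≤ (1 + H).det := by
  have hg : (1 + H).IsHermitian := isHermitian_one.add hH.isHermitian
  have he := one_le_eigenvalues_one_add hH hg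
  rw [hg.det_eq_prod_eigenvalues, trace_one_add hg]
  have key : ∀ s : Finset (Fin d), 1 + ∑ i ∈ s, (hg.eigenvalues i - 1) ≤
      ∏ i ∈ s, hg.eigenvalues i := by
    intro s
    induction s using Finset.induction_on with
    | empty => simp
    | insert a s ha ih =>
      rw [Finset.sum_insert ha, Finset.prod_insert ha]
      have h0 : 0 ≤ ∑ i ∈ s, (hg.eigenvalues i - 1) :=
        Finset.sum_nonneg fun i _ ↦ by linarith [he i]
      nlinarith [he a]
  simpa using key Finset.univ

theorem det_le_exp_trace {H : Matrix (Fin d) (Fin d) ℝ} (hH : H.PosSemidef) :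
    (1 + H).det ≤ exp H.trace := by
  have hg : (1 + H).IsHermitian := isHermitian_one.add hH.isHermitian
  have he := one_le_eigenvalues_one_add hH hg
  rw [hg.det_eq_prod_eigenvalues, trace_one_add hg, Real.exp_sum]
  refine Finset.prod_le_prod (fun i _ ↦ ?_) fun i _ ↦ ?_
  · simpa using zero_le_one.trans (he i)
  · simpa using Real.add_one_le_exp (hg.eigenvalues i - 1)

end Determinant

theorem exp_le_one_add_add_sq_mul {y : ℝ} (hy : 0 ≤ y) : exp y ≤ 1 + y + y ^ 2 * exp y := by
  have h1 := Real.add_one_le_exp (-y)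
  have h2 : exp (-y) * exp y = 1 := by rw [← Real.exp_add]; simp
  have h3 := Real.exp_pos y
  have h4 : exp y - 1 ≤ y * exp y := by nlinarith
  nlinarith

section Forms

variable {d m : ℕ} (M : Fin m → Matrix (Fin d) (Fin d) ℝ)

/-- The quadratic form `∑ₖ ‖Mₖ x‖²`. -/
def gradForm (x : Fin d → ℝ) : ℝ := ∑ k, (M k *ᵥ x) ⬝ᵥ (M k *ᵥ x)

/-- The quartic form `∑ₖ Qₖ(x)²`. -/
def quarticForm (x : Fin d → ℝ) : ℝ := ∑ k, (x ⬝ᵥ (M k *ᵥ x)) ^ 2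

theorem gradForm_nonneg (x : Fin d → ℝ) : 0 ≤ gradForm M x :=
  Finset.sum_nonneg fun _ _ ↦ Finset.sum_nonneg fun _ _ ↦ mul_self_nonneg _

theorem quarticForm_nonneg (x : Fin d → ℝ) : 0 ≤ quarticForm M x :=
  Finset.sum_nonneg fun _ _ ↦ sq_nonneg _

theorem gradForm_smul (r : ℝ) (x : Fin d → ℝ) : gradForm M (r • x) = r ^ 2 * gradForm M x := by
  simp only [gradForm, Finset.mul_sum, mulVec_smul, smul_dotProduct, dotProduct_smul, smul_eq_mul]
  exact Finset.sum_congr rfl fun _ _ ↦ by ring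

theorem quarticForm_smul (r : ℝ) (x : Fin d → ℝ) :
    quarticForm M (r • x) = r ^ 4 * quarticForm M x := by
  simp only [quarticForm, Finset.mul_sum, mulVec_smul, smul_dotProduct, dotProduct_smul,
    smul_eq_mul]
  exact Finset.sum_congr rfl fun _ _ ↦ by ring

theorem continuous_gradForm : Continuous (gradForm M) := by
  unfold gradForm
  fun_prop

theorem continuous_quarticForm : Continuous (quarticForm M) := by
  unfold quarticForm
  fun_prop

theorem continuous_Sdens : Continuous (Sdens M) := by
  unfold Sdens gMat
  fun_prop

theorem posSemidef_gram (x : Fin d → ℝ) :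
    ((4 : ℝ) • ∑ k, vecMulVec (M k *ᵥ x) (M k *ᵥ x)).PosSemidef := by
  refine PosSemidef.smul (posSemidef_sum _ fun k _ ↦ ?_) (by norm_num)
  simpa using posSemidef_vecMulVec_self_star (M k *ᵥ x)

theorem trace_gram (x : Fin d → ℝ) :
    ((4 : ℝ) • ∑ k, vecMulVec (M k *ᵥ x) (M k *ᵥ x)).trace = 4 * gradForm M x := by
  rw [trace_smul, trace_sum, smul_eq_mul, gradForm]
  simp only [trace_vecMulVec]

theorem one_le_Sdens (x : Fin d → ℝ) : 1 ≤ Sdens M x := by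
  rw [Sdens, Real.one_le_sqrt]
  have h := one_add_trace_le_det (posSemidef_gram M x)
  rw [trace_gram] at h
  exact (by linarith [gradForm_nonneg M x] : _ ≤ _).trans h

theorem abs_Sdens_sub_le {c : ℝ} {x : Fin d → ℝ} (hx : gradForm M x ≤ c) :
    |Sdens M x - (1 + 2 * gradForm M x)| ≤ (2 + 4 * exp (2 * c)) * gradForm M x ^ 2 := by
  have hp := gradForm_nonneg M x
  have hlow := one_add_trace_le_det (posSemidef_gram M x)
  have hupp := det_le_exp_trace (posSemidef_gram M x)
  rw [trace_gram] at hlow hupp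
  change _ ≤ (gMat M x).det at hlow
  change (gMat M x).det ≤ _ at hupp
  have hec : exp (2 * gradForm M x) ≤ exp (2 * c) := Real.exp_le_exp.2 (by linarith)
  generalize gradForm M x = p at *
  have hexp := exp_le_one_add_add_sq_mul (y := 2 * p) (by linarith)
  have hu : Sdens M x ≤ exp (2 * p) := by
    rw [Sdens, Real.sqrt_le_left (Real.exp_pos _).le, ← Real.exp_nat_mul]
    convert hupp using 2
    push_cast
    ring
  have hl : 1 + 2 * p - 2 * p ^ 2 ≤ Sdens M x := by
    rcases le_or_gt p 2 with h2 | h2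
    · refine Real.le_sqrt_of_sq_le (le_trans ?_ hlow)
      have : 0 ≤ p ^ 3 * (2 - p) := mul_nonneg (by positivity) (by linarith)
      nlinarith
    · have : 0 ≤ Sdens M x := Real.sqrt_nonneg _
      nlinarith
  have h4 : p ^ 2 * exp (2 * p) ≤ p ^ 2 * exp (2 * c) := by gcongr
  have h5 : 0 ≤ p ^ 2 * exp (2 * c) := by positivity
  rw [abs_le]
  constructor <;> nlinarith

theorem norm_le_Lam (j : Fin m) : ‖toEuclideanCLM (𝕜 := ℝ) (M j)‖ ≤ Lam M :=
  le_ciSup (f := fun j ↦ ‖toEuclideanCLM (𝕜 := ℝ) (M j)‖) (Set.finite_range _).bddAbove j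

theorem Lam_nonneg_s14 : 0 ≤ Lam M := Real.iSup_nonneg fun _ ↦ norm_nonneg _

theorem mulVec_dotProduct_self_le (j : Fin m) (x : Fin d → ℝ) :
    (M j *ᵥ x) ⬝ᵥ (M j *ᵥ x) ≤ Lam M ^ 2 * (x ⬝ᵥ x) := by
  have h := (toEuclideanCLM (𝕜 := ℝ) (M j)).le_of_opNorm_le (norm_le_Lam M j) (WithLp.toLp 2 x)
  rw [toEuclideanCLM_toLp] at h
  have h2 := pow_le_pow_left₀ (norm_nonneg _) h 2
  rw [mul_pow, EuclideanSpace.real_norm_sq_eq, EuclideanSpace.real_norm_sq_eq] at h2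
  simpa only [dotProduct, ← sq] using h2

theorem dotProduct_sq_le (x y : Fin d → ℝ) : (x ⬝ᵥ y) ^ 2 ≤ (x ⬝ᵥ x) * (y ⬝ᵥ y) := by
  simpa only [dotProduct, ← sq] using Finset.sum_mul_sq_le_sq_mul_sq Finset.univ x y

theorem quarticForm_le_gradForm {x : Fin d → ℝ} (hx : x ⬝ᵥ x = 1) :
    quarticForm M x ≤ gradForm M x :=
  Finset.sum_le_sum fun k _ ↦ by simpa [hx] using dotProduct_sq_le x (M k *ᵥ x)

theorem gradForm_le {x : Fin d → ℝ} (hx : x ⬝ᵥ x = 1) : gradForm M x ≤ m * Lam M ^ 2 := by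
  refine (Finset.sum_le_card_nsmul _ _ (Lam M ^ 2) fun k _ ↦ ?_).trans (by simp)
  simpa [hx] using mulVec_dotProduct_self_le M k x

end Forms

section TraceBounds

variable {d : ℕ} {N : Matrix (Fin d) (Fin d) ℝ}

theorem trace_mul_self_eq (hN : N.IsSymm) : (N * N).trace = ∑ i, N i ⬝ᵥ N i := by
  simp only [trace, diag_apply, mul_apply, dotProduct]
  exact Finset.sum_congr rfl fun i _ ↦ Finset.sum_congr rfl fun j _ ↦ by rw [hN.apply i j]

theorem trace_mul_self_nonneg (hN : N.IsSymm) : 0 ≤ (N * N).trace := by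
  rw [trace_mul_self_eq hN]
  exact Finset.sum_nonneg fun i _ ↦ Finset.sum_nonneg fun j _ ↦ mul_self_nonneg _

theorem trace_sq_le (hN : N.IsSymm) : N.trace ^ 2 ≤ d * (N * N).trace := by
  have h := sq_sum_le_card_mul_sum_sq (s := Finset.univ) (f := fun i ↦ N i i)
  rw [Finset.card_univ, Fintype.card_fin] at h
  refine h.trans ?_
  rw [trace_mul_self_eq hN]
  gcongr with i
  rw [sq]
  exact Finset.single_le_sum (f := fun j ↦ N i j * N i j) (fun j _ ↦ mul_self_nonneg _)
    (Finset.mem_univ i)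

theorem quad_sq_le_trace_mul_self (hN : N.IsSymm) {a : Fin d → ℝ} (ha : a ⬝ᵥ a = 1) :
    (a ⬝ᵥ (N *ᵥ a)) ^ 2 ≤ (N * N).trace := by
  refine (dotProduct_sq_le _ _).trans ?_
  rw [ha, one_mul, trace_mul_self_eq hN]
  refine Finset.sum_le_sum fun i _ ↦ ?_
  have h := dotProduct_sq_le (N i) a
  rw [ha, mul_one, sq] at h
  exact h

theorem trace_mul_self_le {m : ℕ} (M : Fin m → Matrix (Fin d) (Fin d) ℝ)
    (hM : ∀ j, (M j).IsSymm) (j : Fin m) : (M j * M j).trace ≤ d * Lam M ^ 2 := by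
  rw [trace_mul_self_eq (hM j)]
  refine (Finset.sum_le_card_nsmul _ _ (Lam M ^ 2) fun i _ ↦ ?_).trans (by simp)
  have h := mulVec_dotProduct_self_le M j (Pi.single i 1)
  have e : M j *ᵥ Pi.single i 1 = M j i := by
    ext k
    rw [mulVec_single_one, col_apply, (hM j).apply]
  rw [e] at h
  simpa using h

end TraceBounds

section Region

variable {d m : ℕ} (M : Fin m → Matrix (Fin d) (Fin d) ℝ)

theorem regionR_eq : regionR M = {x | ∑ i, x i ^ 2 + quarticForm M x ≤ 1} := rfl

theorem isCompact_regionR : IsCompact (regionR M) := by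
  refine Metric.isCompact_of_isClosed_isBounded ?_ ?_
  · rw [regionR_eq]
    exact isClosed_le (by have := continuous_quarticForm M; fun_prop) continuous_const
  · refine (Metric.isBounded_closedBall (x := (0 : Fin d → ℝ)) (r := 1)).subset fun x hx ↦ ?_
    rw [mem_closedBall_zero_iff, pi_norm_le_iff_of_nonneg zero_le_one]
    intro i
    rw [regionR_eq, Set.mem_ofPred_eq] at hx
    have h1 : x i ^ 2 ≤ ∑ i, x i ^ 2 :=
      Finset.single_le_sum (f := fun i ↦ x i ^ 2) (fun _ _ ↦ sq_nonneg _) (Finset.mem_univ i)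
    rw [Real.norm_eq_abs, ← sq_le_one_iff_abs_le_one]
    linarith [quarticForm_nonneg M x]

theorem smul_mem_regionR_iff (w : USphere d) {r : ℝ} (hr : 0 ≤ r) :
    r • w.vec ∈ regionR M ↔ r ≤ rootRadius (quarticForm M w.vec) := by
  rw [regionR_eq, Set.mem_ofPred_eq, quarticForm_smul,
    ← le_rootRadius_iff (quarticForm_nonneg M _) hr]
  simp only [Pi.smul_apply, smul_eq_mul, mul_pow, ← Finset.mul_sum, w.sum_sq, mul_one]

theorem integral_regionR (hd : 1 ≤ d) (k : ℕ) {f : (Fin d → ℝ) → ℝ} (hf : Continuous f)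
    (hfk : ∀ (r : ℝ) x, f (r • x) = r ^ k * f x) :
    Integrable (fun w : USphere d ↦ f w.vec *
      ∫ r in Set.Ioc 0 (rootRadius (quarticForm M w.vec)),
        r ^ (d - 1 + k) * Sdens M (r • w.vec)) (surf d) ∧
    ∫ x in regionR M, f x * Sdens M x = ∫ w : USphere d, f w.vec *
      (∫ r in Set.Ioc 0 (rootRadius (quarticForm M w.vec)),
        r ^ (d - 1 + k) * Sdens M (r • w.vec)) ∂(surf d) := by
  have hmeas := (isCompact_regionR M).measurableSet
  have hint : Integrable ((regionR M).indicator fun x ↦ f x * Sdens M x) :=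
    (integrable_indicator_iff hmeas).2
      ((hf.mul (continuous_Sdens M)).continuousOn.integrableOn_compact (isCompact_regionR M))
  have h := integral_polar hd _ hint
  have hinner : ∀ w : USphere d, ∫ r in Set.Ioi (0 : ℝ), r ^ (d - 1) *
      (regionR M).indicator (fun x ↦ f x * Sdens M x) (r • w.vec) =
      f w.vec * ∫ r in Set.Ioc 0 (rootRadius (quarticForm M w.vec)),
        r ^ (d - 1 + k) * Sdens M (r • w.vec) := by
    intro w
    rw [← Set.Ioi_inter_Iic, ← setIntegral_indicator measurableSet_Iic, ← integral_const_mul]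
    refine setIntegral_congr_fun measurableSet_Ioi fun r hr ↦ ?_
    have hiff := smul_mem_regionR_iff M w (le_of_lt hr)
    by_cases hmem : r • w.vec ∈ regionR M
    · simp only [Set.indicator_of_mem hmem, Set.indicator_of_mem (Set.mem_Iic.2 (hiff.1 hmem)),
        hfk, pow_add]
      ring
    · have hn : r ∉ Set.Iic (rootRadius (quarticForm M w.vec)) := fun h ↦ hmem (hiff.2 h)
      simp only [Set.indicator_of_notMem hmem, Set.indicator_of_notMem hn, mul_zero]
  simp only [hinner] at h
  rw [← integral_indicator hmeas]
  exact h

theorem USphere.dotProduct_self (w : USphere d) : w.vec ⬝ᵥ w.vec = 1 := by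
  simpa only [dotProduct, ← sq] using w.sum_sq

theorem integrable_sphere_of_continuous {f : (Fin d → ℝ) → ℝ} (hf : Continuous f) :
    Integrable (fun w : USphere d ↦ f w.vec) (surf d) :=
  (hf.comp USphere.continuous_vec).integrable_of_hasCompactSupport
    (HasCompactSupport.of_compactSpace _)

theorem abs_integral_regionR_sub_le (hd : 1 ≤ d) (hL : Lam M ≤ 1) (k : ℕ)
    {f : (Fin d → ℝ) → ℝ} (hf : Continuous f)
    (hfk : ∀ (r : ℝ) x, f (r • x) = r ^ k * f x) (hf1 : ∀ w : USphere d, |f w.vec| ≤ 1) :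
    |(∫ x in regionR M, f x * Sdens M x) - ∫ w : USphere d, f w.vec *
      (1 / ((d : ℝ) + k) - quarticForm M w.vec / 2 + 2 * gradForm M w.vec / ((d : ℝ) + k + 2))
        ∂(surf d)| ≤
      (surf d).real Set.univ *
        (((2 + 4 * exp (2 * m)) + 4 * ((d : ℝ) + k) + 2) * m ^ 2 * Lam M ^ 4) := by
  have hp := continuous_gradForm M
  have hq := continuous_quarticForm M
  have hS := continuous_Sdens M
  obtain ⟨hi, he⟩ := integral_regionR M hd k hf hfk
  have hL2 : Lam M ^ 2 ≤ 1 := pow_le_one₀ (Lam_nonneg_s14 M) hL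
  rw [he, ← integral_sub hi (integrable_sphere_of_continuous (f := fun x ↦ f x *
    (1 / ((d : ℝ) + k) - quarticForm M x / 2 + 2 * gradForm M x / ((d : ℝ) + k + 2)))
    (by fun_prop)), mul_comm ((surf d).real _), ← Real.norm_eq_abs]
  refine norm_integral_le_of_norm_le_const (μ := surf d) (.of_forall fun w ↦ ?_)
  have hw := w.dotProduct_self
  have hp0 := gradForm_nonneg M w.vec
  have hq0 := quarticForm_nonneg M w.vec
  have hpb := gradForm_le M hw
  have hqp := quarticForm_le_gradForm M hw
  have hpm : gradForm M w.vec ≤ m := hpb.trans (mul_le_of_le_one_right (by positivity) hL2)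
  have hprof := abs_integral_profile_sub_le (d - 1 + k) hq0 hp0
    (s := fun r ↦ Sdens M (r • w.vec)) (by fun_prop)
    (ε := (2 + 4 * exp (2 * m)) * gradForm M w.vec ^ 2) (fun r hr ↦ by
      have hr2 : r ^ 2 ≤ 1 := pow_le_one₀ hr.1 hr.2
      have hle : gradForm M (r • w.vec) ≤ gradForm M w.vec := by
        rw [gradForm_smul]
        exact mul_le_of_le_one_left hp0 hr2
      have h := abs_Sdens_sub_le M (hle.trans hpm)
      have e : 1 + 2 * gradForm M w.vec * r ^ 2 = 1 + 2 * gradForm M (r • w.vec) := by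
        rw [gradForm_smul]
        ring
      rw [e]
      refine h.trans ?_
      have := gradForm_nonneg M (r • w.vec)
      gcongr)
  have hcast : ((d - 1 + k : ℕ) : ℝ) + 1 = d + k := by
    push_cast [hd]
    ring
  have hcast3 : ((d - 1 + k : ℕ) : ℝ) + 3 = d + k + 2 := by
    linarith
  rw [hcast, hcast3] at hprof
  rw [← mul_sub, norm_mul, Real.norm_eq_abs, Real.norm_eq_abs]
  refine (mul_le_of_le_one_left (abs_nonneg _) (hf1 w)).trans (hprof.trans ?_)
  have hp2 : gradForm M w.vec ^ 2 ≤ m ^ 2 * Lam M ^ 4 := by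
    calc gradForm M w.vec ^ 2 ≤ (m * Lam M ^ 2) ^ 2 := by gcongr
      _ = _ := by ring
  have hq2 : quarticForm M w.vec ^ 2 ≤ gradForm M w.vec ^ 2 := by gcongr
  have hpq : 2 * gradForm M w.vec * quarticForm M w.vec ≤ 2 * gradForm M w.vec ^ 2 := by
    nlinarith
  have hdk : (0 : ℝ) ≤ d + k := by positivity
  calc (2 + 4 * exp (2 * m)) * gradForm M w.vec ^ 2 + 4 * ((d : ℝ) + k) *
        quarticForm M w.vec ^ 2 + 2 * gradForm M w.vec * quarticForm M w.vec
      ≤ (2 + 4 * exp (2 * m)) * gradForm M w.vec ^ 2 + 4 * ((d : ℝ) + k) *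
        gradForm M w.vec ^ 2 + 2 * gradForm M w.vec ^ 2 := by gcongr
    _ = ((2 + 4 * exp (2 * m)) + 4 * ((d : ℝ) + k) + 2) * gradForm M w.vec ^ 2 := by ring
    _ ≤ ((2 + 4 * exp (2 * m)) + 4 * ((d : ℝ) + k) + 2) * (m ^ 2 * Lam M ^ 4) := by gcongr
    _ = _ := by ring

theorem le_integral_regionR_Sdens (hd : 1 ≤ d) (hL : Lam M ≤ 1) :
    (surf d).real Set.univ * ((1 / (1 + (m : ℝ))) ^ d / d) ≤ ∫ x in regionR M, Sdens M x := by
  have hS := continuous_Sdens M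
  obtain ⟨hi, he⟩ := integral_regionR M hd 0 (f := fun _ ↦ 1) continuous_const (by simp)
  simp only [one_mul, add_zero] at hi he
  have hL2 : Lam M ^ 2 ≤ 1 := pow_le_one₀ (Lam_nonneg_s14 M) hL
  rw [he]
  have hc : ∫ _ : USphere d, (1 / (1 + (m : ℝ))) ^ d / d ∂(surf d) =
      (surf d).real Set.univ * ((1 / (1 + (m : ℝ))) ^ d / d) := by
    rw [integral_const, smul_eq_mul]
  rw [← hc]
  refine integral_mono (integrable_const _) hi fun w ↦ ?_
  have hw := w.dotProduct_self
  have hqm : quarticForm M w.vec ≤ m := (quarticForm_le_gradForm M hw).trans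
    ((gradForm_le M hw).trans (mul_le_of_le_one_right (by positivity) hL2))
  have h := le_integral_profile (d - 1) (quarticForm_nonneg M w.vec) hqm
    (s := fun r ↦ Sdens M (r • w.vec)) (by fun_prop) fun r ↦ one_le_Sdens M _
  push_cast [hd] at h
  simpa only [Nat.sub_add_cancel hd, sub_add_cancel] using h

end Region

section Moments

variable {d m : ℕ} (M : Fin m → Matrix (Fin d) (Fin d) ℝ)

theorem surf_real_univ_pos (hd : 1 ≤ d) : 0 < (surf d).real Set.univ := by
  have : Nonempty (Fin d) := ⟨⟨0, hd⟩⟩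
  rw [Measure.real, ENNReal.toReal_pos_iff, Measure.measure_univ_pos]
  exact ⟨Measure.toSphere_ne_zero _, measure_lt_top _ _⟩

theorem integral_sphere_mul_profile {f : (Fin d → ℝ) → ℝ} (hf : Continuous f) (c e : ℝ) :
    ∫ w : USphere d, f w.vec * (c - quarticForm M w.vec / 2 + 2 * gradForm M w.vec / e)
        ∂(surf d) =
      c * (∫ w : USphere d, f w.vec ∂(surf d)) -
        (∑ k, ∫ w : USphere d, f w.vec * (w.vec ⬝ᵥ (M k *ᵥ w.vec)) ^ 2 ∂(surf d)) / 2 +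
        2 * (∑ k, ∫ w : USphere d, f w.vec * ((M k *ᵥ w.vec) ⬝ᵥ (M k *ᵥ w.vec)) ∂(surf d)) /
          e := by
  have hM (k : Fin m) : Continuous fun x ↦ M k *ᵥ x := continuous_const.matrix_mulVec continuous_id
  have hq (k : Fin m) : Continuous fun x ↦ f x * (x ⬝ᵥ (M k *ᵥ x)) ^ 2 :=
    hf.mul ((continuous_id.dotProduct (hM k)).pow 2)
  have hp (k : Fin m) : Continuous fun x ↦ f x * ((M k *ᵥ x) ⬝ᵥ (M k *ᵥ x)) :=
    hf.mul ((hM k).dotProduct (hM k))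
  have iq := integrable_finsetSum Finset.univ
    fun k _ ↦ integrable_sphere_of_continuous (hq k)
  have ip := integrable_finsetSum Finset.univ
    fun k _ ↦ integrable_sphere_of_continuous (hp k)
  have i0 := integrable_sphere_of_continuous hf
  have i0q : Integrable (fun w : USphere d ↦ c * f w.vec -
      (∑ k, f w.vec * (w.vec ⬝ᵥ (M k *ᵥ w.vec)) ^ 2) / 2) (surf d) :=
    (i0.const_mul c).sub (iq.div_const 2)
  rw [← integral_finsetSum _ fun k _ ↦ integrable_sphere_of_continuous (hq k),
    ← integral_finsetSum _ fun k _ ↦ integrable_sphere_of_continuous (hp k),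
    ← integral_const_mul, ← integral_div, mul_div_right_comm, ← integral_const_mul,
    ← integral_sub (i0.const_mul c) (iq.div_const 2),
    ← integral_add i0q (ip.const_mul (2 / e))]
  refine integral_congr_ae (.of_forall fun w ↦ ?_)
  simp only [quarticForm, gradForm, ← Finset.mul_sum]
  ring

theorem integral_sphere_profile (hd : 1 ≤ d) (hM : ∀ k, (M k).IsSymm) :
    ∫ w : USphere d, 1 * (1 / (d : ℝ) - quarticForm M w.vec / 2 +
        2 * gradForm M w.vec / ((d : ℝ) + 2)) ∂(surf d) =
      (surf d).real Set.univ * (1 / d - (Bconst M + 2 * Aconst M) / (2 * d * (d + 2)) +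
        2 * Aconst M / (d * (d + 2))) := by
  rw [integral_sphere_mul_profile M (f := fun _ ↦ 1) continuous_const]
  simp only [one_mul, integral_sphere_mulVec_sq hd _ (hM _), integral_sphere_quad_sq hd _ (hM _),
    integral_const, smul_eq_mul, ← Finset.mul_sum, ← Finset.sum_div, Finset.sum_add_distrib]
  have : (0 : ℝ) < d := by exact_mod_cast hd
  rw [Aconst, Bconst]
  field_simp

theorem integral_sphere_lin_sq_mul_profile (hd : 1 ≤ d) (hM : ∀ k, (M k).IsSymm)
    {a : Fin d → ℝ} (ha : a ⬝ᵥ a = 1) :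
    ∫ w : USphere d, (w.vec ⬝ᵥ a) ^ 2 * (1 / ((d : ℝ) + 2) - quarticForm M w.vec / 2 +
        2 * gradForm M w.vec / ((d : ℝ) + 2 + 2)) ∂(surf d) =
      (surf d).real Set.univ * (1 / (d * (d + 2)) -
        (Bconst M + 4 * ∑ k, (M k).trace * (a ⬝ᵥ (M k *ᵥ a)) - 2 * Aconst M) /
          (2 * d * (d + 2) * (d + 4))) := by
  rw [integral_sphere_mul_profile M (f := fun x ↦ (x ⬝ᵥ a) ^ 2)
    ((continuous_id.dotProduct continuous_const).pow 2)]
  simp only [integral_sphere_lin_sq hd a ha, integral_sphere_lin_sq_mul_mulVec_sq hd _ (hM _) a ha,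
    integral_sphere_lin_sq_mul_quad_sq hd _ (hM _) a ha, ← Finset.mul_sum, ← Finset.sum_div,
    Finset.sum_add_distrib, mul_assoc (4 : ℝ)]
  have : (0 : ℝ) < d := by exact_mod_cast hd
  have h4 : (d : ℝ) + 2 + 2 = d + 4 := by ring
  rw [Aconst, Bconst, h4]
  field_simp
  ring

end Moments

section Comparison

variable {d m : ℕ} (M : Fin m → Matrix (Fin d) (Fin d) ℝ)

theorem correction_summand_le {d : ℝ} (hd : 0 < d) {t μ a : ℝ} (ht : t ^ 2 ≤ d * a)
    (hμ : μ ^ 2 ≤ a) :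
    (t ^ 2 - 2 * a - 2 * (d + 2) * (t * μ)) / ((d + 2) ^ 2 * (d + 4)) ≤
      (5 * d ^ 2 + 18 * d + 24) * a / ((d + 2) ^ 3 * (d + 4)) +
        d * t ^ 2 / (2 * (d + 2) ^ 2 * (d + 4)) := by
  have key : 2 * (d + 2) * (t ^ 2 - 2 * a - 2 * (d + 2) * (t * μ)) ≤
      2 * (5 * d ^ 2 + 18 * d + 24) * a + (d + 2) * d * t ^ 2 := by
    have h1 : 0 ≤ (d + 2) ^ 2 * (t + 2 * μ) ^ 2 := by positivity
    nlinarith [mul_le_mul_of_nonneg_left hμ (by positivity : 0 ≤ 4 * (d + 2) ^ 2),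
      mul_le_mul_of_nonneg_left ht (by positivity : 0 ≤ 4 * (d + 2)), sq_nonneg μ]
  rw [div_add_div _ _ (by positivity) (by positivity), div_le_div_iff₀ (by positivity)
    (by positivity)]
  have := mul_le_mul_of_nonneg_left key (by positivity : 0 ≤ (d + 2) ^ 4 * (d + 4) ^ 2)
  linarith

theorem Aconst_nonneg (hM : ∀ k, (M k).IsSymm) : 0 ≤ Aconst M :=
  Finset.sum_nonneg fun k _ ↦ trace_mul_self_nonneg (hM k)

theorem Bconst_nonneg : 0 ≤ Bconst M := Finset.sum_nonneg fun _ _ ↦ sq_nonneg _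

theorem Bconst_le (hM : ∀ k, (M k).IsSymm) : Bconst M ≤ d * Aconst M := by
  rw [Bconst, Aconst, Finset.mul_sum]
  exact Finset.sum_le_sum fun k _ ↦ trace_sq_le (hM k)

theorem Aconst_le (hM : ∀ k, (M k).IsSymm) : Aconst M ≤ m * (d * Lam M ^ 2) := by
  refine (Finset.sum_le_card_nsmul _ _ _ fun k _ ↦ trace_mul_self_le M hM k).trans ?_
  simp

theorem abs_sum_trace_mul_quad_le (hM : ∀ k, (M k).IsSymm) {a : Fin d → ℝ} (ha : a ⬝ᵥ a = 1) :
    |∑ k, (M k).trace * (a ⬝ᵥ (M k *ᵥ a))| ≤ (Aconst M + Bconst M) / 2 := by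
  refine (Finset.abs_sum_le_sum_abs _ _).trans ?_
  rw [Aconst, Bconst, ← Finset.sum_add_distrib, Finset.sum_div]
  refine Finset.sum_le_sum fun k _ ↦ ?_
  have h := quad_sq_le_trace_mul_self (hM k) ha
  rw [abs_le]
  constructor <;>
    nlinarith [sq_nonneg ((M k).trace + a ⬝ᵥ (M k *ᵥ a)),
      sq_nonneg ((M k).trace - a ⬝ᵥ (M k *ᵥ a))]

/-- The second-order correction to the ratio of the two integrals. -/
noncomputable def ratioCorrection (a : Fin d → ℝ) : ℝ :=
  (Bconst M - 2 * Aconst M - 2 * (d + 2) * ∑ k, (M k).trace * (a ⬝ᵥ (M k *ᵥ a))) /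
    ((d + 2) ^ 2 * (d + 4))

theorem ratioCorrection_le (hd : 1 ≤ d) (hM : ∀ k, (M k).IsSymm) {a : Fin d → ℝ}
    (ha : a ⬝ᵥ a = 1) :
    ratioCorrection M a ≤
      (5 * (d : ℝ) ^ 2 + 18 * d + 24) * Aconst M / ((d + 2) ^ 3 * (d + 4)) +
        d * Bconst M / (2 * (d + 2) ^ 2 * (d + 4)) := by
  have hd0 : (0 : ℝ) < d := by exact_mod_cast hd
  simp only [ratioCorrection, Aconst, Bconst, Finset.mul_sum, Finset.sum_div,
    ← Finset.sum_sub_distrib, ← Finset.sum_add_distrib]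
  exact Finset.sum_le_sum fun k _ ↦
    correction_summand_le hd0 (trace_sq_le (hM k)) (quad_sq_le_trace_mul_self (hM k) ha)

theorem abs_ratioCorrection_le (hM : ∀ k, (M k).IsSymm) {a : Fin d → ℝ} (ha : a ⬝ᵥ a = 1) :
    |ratioCorrection M a| ≤ Aconst M + Bconst M := by
  have hX := abs_le.1 (abs_sum_trace_mul_quad_le M hM ha)
  have hA := Aconst_nonneg M hM
  have hB := Bconst_nonneg M
  have hd0 : (0 : ℝ) ≤ d := d.cast_nonneg
  rw [ratioCorrection, abs_div, abs_of_pos (by positivity : (0 : ℝ) < (d + 2) ^ 2 * (d + 4)),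
    div_le_iff₀ (by positivity)]
  have h : |Bconst M - 2 * Aconst M - 2 * (d + 2) * ∑ k, (M k).trace * (a ⬝ᵥ (M k *ᵥ a))| ≤
      (Aconst M + Bconst M) * (d + 4) := by
    rw [abs_le]
    constructor <;> nlinarith
  refine h.trans (mul_le_mul_of_nonneg_left ?_ (by positivity))
  nlinarith

theorem abs_density_correction_le (hd : 1 ≤ d) (hM : ∀ k, (M k).IsSymm) :
    |(2 * Aconst M - Bconst M) / (2 * d * (d + 2))| ≤ Aconst M + Bconst M := by
  have hA := Aconst_nonneg M hM
  have hB := Bconst_nonneg M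
  have hd1 : (1 : ℝ) ≤ d := by exact_mod_cast hd
  rw [abs_div, abs_of_pos (by positivity : (0 : ℝ) < 2 * d * (d + 2)), div_le_iff₀ (by positivity)]
  have h : |2 * Aconst M - Bconst M| ≤ (Aconst M + Bconst M) * 2 := by
    rw [abs_le]
    constructor <;> linarith
  refine h.trans (mul_le_mul_of_nonneg_left ?_ (by positivity))
  nlinarith

theorem Aconst_add_Bconst_le (hM : ∀ k, (M k).IsSymm) :
    Aconst M + Bconst M ≤ m * d * (1 + d) * Lam M ^ 2 := by
  have hA := Aconst_le M hM
  have hB := Bconst_le M hM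
  have hd0 : (0 : ℝ) ≤ d := d.cast_nonneg
  nlinarith [mul_le_mul_of_nonneg_left hA hd0]

theorem div_le_of_approx {N P T c ν δ b e d₁ E K₁ L : ℝ} (hT : 0 < T) (hc : 0 < c) (hb0 : 0 ≤ b)
    (hb : b ≤ 1) (hP : T * c ≤ P) (hN : |N - T * ν| ≤ T * E) (hD : |P - T * δ| ≤ T * E)
    (hid : ν - (b + e) * δ = -e * d₁) (he : |e| ≤ K₁ * L) (hd₁ : |d₁| ≤ K₁ * L)
    (hKL : K₁ * L ≤ K₁) :
    N / P ≤ b + e + ((K₁ * L) ^ 2 + (2 + K₁) * E) / c := by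
  have hP0 : 0 < P := (mul_pos hT hc).trans_le hP
  have hE : 0 ≤ E := nonneg_of_mul_nonneg_right ((abs_nonneg _).trans hN) hT
  have hK : 0 ≤ K₁ := ((abs_nonneg _).trans he).trans hKL
  have h1 : -(e * d₁) ≤ (K₁ * L) ^ 2 := by
    rw [sq]
    refine (neg_le_abs _).trans ?_
    rw [abs_mul]
    exact mul_le_mul he hd₁ (abs_nonneg _) ((abs_nonneg _).trans he)
  have h2 : |(b + e) * (P - T * δ)| ≤ (1 + K₁) * (T * E) := by
    rw [abs_mul]
    refine mul_le_mul ?_ hD (abs_nonneg _) (by positivity)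
    refine (abs_add_le _ _).trans (add_le_add ?_ (he.trans hKL))
    rwa [abs_of_nonneg hb0]
  have h3 : N - (b + e) * P ≤ T * ((K₁ * L) ^ 2 + (2 + K₁) * E) := by
    have h := mul_le_mul_of_nonneg_left h1 hT.le
    have h' : T * ν - (b + e) * (T * δ) = T * -(e * d₁) := by
      rw [← neg_mul, ← hid]
      ring
    have := (abs_le.1 hN).2
    have := (abs_le.1 h2).1
    linarith
  have h4 := mul_le_mul_of_nonneg_left hP
    (by positivity : 0 ≤ ((K₁ * L) ^ 2 + (2 + K₁) * E) / c)
  rw [mul_left_comm, div_mul_cancel₀ _ hc.ne'] at h4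
  rw [div_le_iff₀ hP0]
  linarith

end Comparison

theorem stmt14 (d D : ℕ) (hd : 1 ≤ d) (hD : d < D) :
    ∃ C > 0, ∀ M : Fin (D - d) → Matrix (Fin d) (Fin d) ℝ,
      (∀ j, (M j).IsSymm) → Lam M ≤ 1 →
      ∀ θstar : Fin d → ℝ, ∑ i, θstar i ^ 2 = 1 →
        (∫ x in regionR M, (x ⬝ᵥ θstar) ^ 2 * Sdens M x) / (∫ x in regionR M, Sdens M x)
          ≤ 1 / ((d : ℝ) + 2) +
              (5 * (d : ℝ) ^ 2 + 18 * (d : ℝ) + 24) * Aconst M /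
                (((d : ℝ) + 2) ^ 3 * ((d : ℝ) + 4)) +
              (d : ℝ) * Bconst M / (2 * ((d : ℝ) + 2) ^ 2 * ((d : ℝ) + 4)) +
              C * Lam M ^ 4 := by
  have hd1 : (1 : ℝ) ≤ d := by exact_mod_cast hd
  set m := D - d
  set K₁ : ℝ := m * d * (1 + d) with hK₁
  set K₂ : ℝ := ((2 + 4 * exp (2 * m)) + 4 * ((d : ℝ) + 2) + 2) * m ^ 2 with hK₂
  set c : ℝ := (1 / (1 + (m : ℝ))) ^ d / d with hc
  have hc0 : 0 < c := by positivity
  refine ⟨(K₁ ^ 2 + (2 + K₁) * K₂) / c + 1, by positivity, fun M hM hL θ hθ ↦ ?_⟩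
  have ha : θ ⬝ᵥ θ = 1 := by simpa only [dotProduct, ← sq] using hθ
  have hL2 : Lam M ^ 2 ≤ 1 := pow_le_one₀ (Lam_nonneg_s14 M) hL
  have hT := surf_real_univ_pos hd
  have hN := abs_integral_regionR_sub_le M hd hL 2 (f := fun x ↦ (x ⬝ᵥ θ) ^ 2)
    ((continuous_id.dotProduct continuous_const).pow 2)
    (fun r x ↦ by rw [smul_dotProduct, smul_eq_mul, mul_pow])
    (fun w ↦ by
      rw [abs_of_nonneg (sq_nonneg _)]
      refine (dotProduct_sq_le _ _).trans ?_
      rw [w.dotProduct_self, ha, one_mul])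
  have hP := abs_integral_regionR_sub_le M hd hL 0 (f := fun _ ↦ 1) continuous_const
    (by simp) (by simp)
  rw [Nat.cast_ofNat, integral_sphere_lin_sq_mul_profile M hd hM ha] at hN
  rw [Nat.cast_zero, add_zero, integral_sphere_profile M hd hM] at hP
  simp only [one_mul] at hP
  have hE : (((2 + 4 * exp (2 * m)) + 4 * (d : ℝ) + 2) * m ^ 2 * Lam M ^ 4) ≤
      K₂ * Lam M ^ 4 := by
    rw [hK₂]
    gcongr
    linarith
  have hS := Aconst_add_Bconst_le M hM
  have hmain := div_le_of_approx hT hc0 (b := 1 / ((d : ℝ) + 2)) (e := ratioCorrection M θ)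
    (by positivity)
    ((div_le_one (by positivity)).2 (by linarith)) (le_integral_regionR_Sdens M hd hL)
    hN (hP.trans (mul_le_mul_of_nonneg_left hE hT.le))
    (d₁ := (2 * Aconst M - Bconst M) / (2 * d * (d + 2)))
    (by
      rw [ratioCorrection]
      field_simp
      ring)
    ((abs_ratioCorrection_le M hM ha).trans hS) ((abs_density_correction_le M hd hM).trans hS)
    (mul_le_of_le_one_right (by positivity) hL2)
  have hcorr := ratioCorrection_le M hd hM ha
  have hC : ((K₁ * Lam M ^ 2) ^ 2 + (2 + K₁) * (K₂ * Lam M ^ 4)) / c ≤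
      ((K₁ ^ 2 + (2 + K₁) * K₂) / c + 1) * Lam M ^ 4 := by
    have : 0 ≤ Lam M ^ 4 := pow_nonneg (Lam_nonneg_s14 M) 4
    have e : ((K₁ * Lam M ^ 2) ^ 2 + (2 + K₁) * (K₂ * Lam M ^ 4)) / c =
        (K₁ ^ 2 + (2 + K₁) * K₂) / c * Lam M ^ 4 := by ring
    linarith
  linarith
end
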